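/- arXiv:2301.06023 — 4 statements merged into one kernel-verified Lean document; each statement's English description precedes it below -/
import Mathlib

section
/- Let f : ℝ × [0,1] → ℝ be continuous and bounded on the closed strip ℝ × [0,1], twice continuously differentiable on the open strip ℝ × (0,1) where it satisfies the Laplace equation ∂²f/∂τ² + ∂²f/∂t² = 0, and suppose f(τ,0) = f(τ,1) = 0 for all τ ∈ ℝ. Then f vanishes identically on the closed strip. -/
open Set

open Filter Topology in
/-- The second derivative is nonpositive at a local maximum. -/
theorem IsLocalMax.iteratedDeriv_two_nonpos {f : ℝ → ℝ} {x : ℝ} (h : IsLocalMax f x)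
    (hf : ContinuousAt f x) : iteratedDeriv 2 f x ≤ 0 := by
  rw [iteratedDeriv_succ, iteratedDeriv_one]
  by_contra! hpos
  have hmin : IsLocalMin f x := isLocalMin_of_deriv_deriv_pos hpos h.deriv_eq_zero hf
  have hconst : f =ᶠ[𝓝 x] fun _ => f x := by
    filter_upwards [h, hmin] with y h₁ h₂ using le_antisymm h₁ h₂
  have hzero : deriv (deriv f) x = 0 := by
    rw [hconst.deriv.deriv_eq]
    simp
  exact hpos.ne' hzero

/-- If `f - q` has a local maximum at `x`, then `f'' x ≤ q'' x`. -/
theorem IsLocalMax.iteratedDeriv_two_le {f q : ℝ → ℝ} {x : ℝ}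
    (h : IsLocalMax (fun y => f y - q y) x) (hf : ContDiffAt ℝ 2 f x) (hq : ContDiffAt ℝ 2 q x) :
    iteratedDeriv 2 f x ≤ iteratedDeriv 2 q x := by
  have hle := h.iteratedDeriv_two_nonpos (hf.sub hq).continuousAt
  rw [iteratedDeriv_fun_sub hf hq] at hle
  linarith

theorem iteratedDeriv_two_mul_sq_add (a b x : ℝ) :
    iteratedDeriv 2 (fun y : ℝ => a * y ^ 2 + b) x = 2 * a := by
  have h : deriv (fun y : ℝ => a * y ^ 2 + b) = fun y => 2 * a * y := by
    ext y
    simp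
    ring
  rw [iteratedDeriv_succ, iteratedDeriv_one, h]
  simp

/-- A maximum principle of Phragmén–Lindelöf type: a subharmonic function on a strip that is
bounded above and nonpositive on the boundary is nonpositive. -/
theorem nonpos_of_subharmonic_strip {f : ℝ × ℝ → ℝ} {M : ℝ}
    (hcont : ContinuousOn f {p : ℝ × ℝ | p.2 ∈ Icc (0 : ℝ) 1})
    (hbdd : ∀ p : ℝ × ℝ, p.2 ∈ Icc (0 : ℝ) 1 → f p ≤ M)
    (hC2 : ContDiffOn ℝ 2 f {p : ℝ × ℝ | p.2 ∈ Ioo (0 : ℝ) 1})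
    (hsub : ∀ p : ℝ × ℝ, p.2 ∈ Ioo (0 : ℝ) 1 →
      0 ≤ iteratedDeriv 2 (fun τ : ℝ => f (τ, p.2)) p.1
        + iteratedDeriv 2 (fun t : ℝ => f (p.1, t)) p.2)
    (hbc : ∀ τ : ℝ, f (τ, 0) ≤ 0 ∧ f (τ, 1) ≤ 0)
    {p : ℝ × ℝ} (hp : p.2 ∈ Icc (0 : ℝ) 1) : f p ≤ 0 := by
  -- Compare `f` with `ε * (τ ^ 2 - 2 * t ^ 2 + 2)`, which is nonnegative and superharmonic.
  have key : ∀ ε > 0, f p ≤ ε * (p.1 ^ 2 - 2 * p.2 ^ 2 + 2) := by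
    intro ε hε
    set g : ℝ × ℝ → ℝ := fun q => f q - ε * (q.1 ^ 2 - 2 * q.2 ^ 2 + 2) with hg
    obtain ⟨R, hpR, hR1, hRM⟩ : ∃ R : ℝ, |p.1| ≤ R ∧ 1 ≤ R ∧ M / ε ≤ R :=
      ⟨max |p.1| (max 1 (M / ε)), by simp, by simp, by simp⟩
    have hMR : M ≤ ε * R ^ 2 := by
      rw [div_le_iff₀ hε] at hRM
      nlinarith [mul_nonneg hε.le (mul_nonneg (zero_le_one.trans hR1) (sub_nonneg.2 hR1))]
    have hgcont : ContinuousOn g (Icc (-R) R ×ˢ Icc (0 : ℝ) 1) :=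
      (hcont.mono fun q hq => hq.2).sub (by fun_prop)
    have hpK : p ∈ Icc (-R) R ×ˢ Icc (0 : ℝ) 1 := ⟨abs_le.1 hpR, hp⟩
    obtain ⟨⟨τ, t⟩, ⟨hτ, ht⟩, hmax⟩ :=
      (isCompact_Icc.prod isCompact_Icc).exists_isMaxOn ⟨p, hpK⟩ hgcont
    simp only at hτ ht
    suffices h : g (τ, t) ≤ 0 by
      have := (hmax hpK).trans h
      simp only [hg] at this
      linarith
    by_contra! hpos
    have ht2 : t ^ 2 ≤ 1 := by nlinarith [ht.1, ht.2]
    simp only [hg] at hpos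
    have ht0 : 0 < t := by
      refine ht.1.lt_of_ne' ?_
      rintro rfl
      nlinarith [(hbc τ).1, mul_nonneg hε.le (sq_nonneg τ)]
    have ht1 : t < 1 := by
      refine ht.2.lt_of_ne ?_
      rintro rfl
      nlinarith [(hbc τ).2, mul_nonneg hε.le (sq_nonneg τ)]
    have hτR : τ ^ 2 < R ^ 2 := by
      have := hbdd (τ, t) ht
      have := mul_nonneg hε.le (sub_nonneg.2 ht2)
      exact lt_of_mul_lt_mul_left (by nlinarith) hε.le
    have hτ' : τ ∈ Ioo (-R) R := abs_lt.1 (abs_lt_of_sq_lt_sq hτR (zero_le_one.trans hR1))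
    have hfC2 : ContDiffAt ℝ 2 f (τ, t) :=
      hC2.contDiffAt ((isOpen_Ioo.preimage continuous_snd).mem_nhds ⟨ht0, ht1⟩)
    have hloc : IsLocalMax g (τ, t) :=
      hmax.isLocalMax (prod_mem_nhds (Icc_mem_nhds hτ'.1 hτ'.2) (Icc_mem_nhds ht0 ht1))
    have hlocτ : IsLocalMax
        (fun x => f (x, t) - (ε * x ^ 2 + ε * (2 - 2 * t ^ 2))) τ := by
      convert hloc.comp_continuous (g := fun x : ℝ => (x, t)) (b := τ) (by fun_prop) using 1
      ext x
      simp only [hg, Function.comp]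
      ring
    have hloct : IsLocalMax
        (fun y => f (τ, y) - (-2 * ε * y ^ 2 + ε * (τ ^ 2 + 2))) t := by
      convert hloc.comp_continuous (g := fun y : ℝ => (τ, y)) (b := t) (by fun_prop) using 1
      ext y
      simp only [hg, Function.comp]
      ring
    have hle₁ := hlocτ.iteratedDeriv_two_le
      (hfC2.comp τ (f := fun x : ℝ => (x, t)) (by fun_prop)) (by fun_prop)
    have hle₂ := hloct.iteratedDeriv_two_le
      (hfC2.comp t (f := fun y : ℝ => (τ, y)) (by fun_prop)) (by fun_prop)
    rw [iteratedDeriv_two_mul_sq_add] at hle₁ hle₂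
    have := hsub (τ, t) ⟨ht0, ht1⟩
    simp only at this
    linarith
  have hc : 0 < p.1 ^ 2 - 2 * p.2 ^ 2 + 2 + 1 := by
    nlinarith [hp.1, hp.2, sq_nonneg p.1]
  refine le_of_forall_pos_le_add fun δ hδ => ?_
  have h := key (δ / (p.1 ^ 2 - 2 * p.2 ^ 2 + 2 + 1)) (by positivity)
  rw [div_mul_eq_mul_div, le_div_iff₀ hc] at h
  by_contra! hlt
  nlinarith

/-- Uniqueness of bounded harmonic functions on the strip `ℝ × [0,1]` with zero
Dirichlet boundary data: if `f` is continuous and bounded on the closed strip,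
twice continuously differentiable on the open strip where it satisfies
`∂²f/∂τ² + ∂²f/∂t² = 0`, and vanishes on both boundary lines, then `f ≡ 0`. -/
theorem bounded_harmonic_strip_zero_dirichlet_vanishes
    (f : ℝ × ℝ → ℝ)
    (hcont : ContinuousOn f {p : ℝ × ℝ | p.2 ∈ Icc (0:ℝ) 1})
    (hbdd : ∃ M : ℝ, ∀ p ∈ {p : ℝ × ℝ | p.2 ∈ Icc (0:ℝ) 1}, |f p| ≤ M)
    (hC2 : ContDiffOn ℝ 2 f {p : ℝ × ℝ | p.2 ∈ Ioo (0:ℝ) 1})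
    (hharm : ∀ p ∈ {p : ℝ × ℝ | p.2 ∈ Ioo (0:ℝ) 1},
      deriv (deriv (fun τ : ℝ => f (τ, p.2))) p.1
        + deriv (deriv (fun t : ℝ => f (p.1, t))) p.2 = 0)
    (hbc : ∀ τ : ℝ, f (τ, 0) = 0 ∧ f (τ, 1) = 0) :
    ∀ p ∈ {p : ℝ × ℝ | p.2 ∈ Icc (0:ℝ) 1}, f p = 0 := by
  obtain ⟨M, hM⟩ := hbdd
  have hΔ : ∀ p : ℝ × ℝ, p.2 ∈ Ioo (0 : ℝ) 1 →
      iteratedDeriv 2 (fun τ : ℝ => f (τ, p.2)) p.1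
        + iteratedDeriv 2 (fun t : ℝ => f (p.1, t)) p.2 = 0 := by
    intro p hp
    simpa only [iteratedDeriv_succ, iteratedDeriv_zero] using hharm p hp
  intro p hp
  refine le_antisymm ?_ (neg_nonpos.1 ?_)
  · exact nonpos_of_subharmonic_strip hcont (fun q hq => (abs_le.1 (hM q hq)).2) hC2
      (fun q hq => (hΔ q hq).ge) (fun τ => ⟨(hbc τ).1.le, (hbc τ).2.le⟩) hp
  · refine nonpos_of_subharmonic_strip (f := fun q => -f q) hcont.neg
      (fun q hq => (neg_le_abs _).trans (hM q hq)) hC2.neg (fun q hq => ?_)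
      (fun τ => by simp [hbc τ]) hp
    simp only [iteratedDeriv_fun_neg]
    linarith [hΔ q hq]
end

section
/- Let f, g : ℝ × [0,1] → ℝ be bounded continuous functions that are differentiable on the open strip ℝ × (0,1) and satisfy there the Cauchy–Riemann system ∂f/∂t = ∂g/∂τ and ∂f/∂τ = −∂g/∂t. If f(τ,0) = f(τ,1) = 0 for all τ ∈ ℝ, then f ≡ 0 on the closed strip and g is equal to a constant b ∈ ℝ; equivalently, the one-form f dτ + g dt equals b dt. -/
open Set

/-- A pair of real-differentiable functions whose partial derivatives satisfy the Cauchy–Riemann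
equations combines to a complex-differentiable function. -/
theorem differentiableAt_complex_of_cauchyRiemann {u v : ℝ × ℝ → ℝ} {z : ℂ}
    (hu : DifferentiableAt ℝ u (z.re, z.im)) (hv : DifferentiableAt ℝ v (z.re, z.im))
    (h₁ : deriv (fun x : ℝ => u (x, z.im)) z.re = deriv (fun y : ℝ => v (z.re, y)) z.im)
    (h₂ : deriv (fun y : ℝ => u (z.re, y)) z.im = -deriv (fun x : ℝ => v (x, z.im)) z.re) :
    DifferentiableAt ℂ (fun w : ℂ => (⟨u (w.re, w.im), v (w.re, w.im)⟩ : ℂ)) z := by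
  have partial_fst : ∀ {h : ℝ × ℝ → ℝ}, DifferentiableAt ℝ h (z.re, z.im) →
      deriv (fun x : ℝ => h (x, z.im)) z.re = fderiv ℝ h (z.re, z.im) (1, 0) := fun hh =>
    (hh.hasFDerivAt.comp_hasDerivAt z.re
      ((hasDerivAt_id z.re).prodMk (hasDerivAt_const z.re z.im))).deriv
  have partial_snd : ∀ {h : ℝ × ℝ → ℝ}, DifferentiableAt ℝ h (z.re, z.im) →
      deriv (fun y : ℝ => h (z.re, y)) z.im = fderiv ℝ h (z.re, z.im) (0, 1) := fun hh =>
    (hh.hasFDerivAt.comp_hasDerivAt z.im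
      ((hasDerivAt_const z.im z.re).prodMk (hasDerivAt_id z.im))).deriv
  rw [partial_fst hu, partial_snd hv] at h₁
  rw [partial_snd hu, partial_fst hv] at h₂
  have hF := Complex.equivRealProdCLM.symm.toContinuousLinearMap.hasFDerivAt.comp z
    ((hu.hasFDerivAt.prodMk hv.hasFDerivAt).comp z
      Complex.equivRealProdCLM.toContinuousLinearMap.hasFDerivAt)
  have hF' : HasFDerivAt (fun w : ℂ => (⟨u (w.re, w.im), v (w.re, w.im)⟩ : ℂ)) _ z :=
    hF.congr_of_eventuallyEq <| .of_forall fun w => by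
      apply Complex.ext <;> simp
  refine differentiableAt_complex_iff_differentiableAt_real.2 ⟨hF'.differentiableAt, ?_⟩
  rw [hF'.fderiv]
  apply Complex.ext <;> simp [h₁, h₂]

/-- A bounded holomorphic function on a horizontal strip with nonnegative imaginary part on the
boundary lines has nonnegative imaginary part on the whole closed strip. -/
theorem im_nonneg_of_horizontal_strip {F : ℂ → ℂ} {a b M : ℝ} (hab : a < b)
    (hF : DiffContOnCl ℂ F (Complex.im ⁻¹' Ioo a b))
    (hM : ∀ z ∈ Complex.im ⁻¹' Ioo a b, -M ≤ (F z).im)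
    (ha : ∀ z : ℂ, z.im = a → 0 ≤ (F z).im) (hb : ∀ z : ℂ, z.im = b → 0 ≤ (F z).im)
    {z : ℂ} (hz : z.im ∈ Icc a b) : 0 ≤ (F z).im := by
  have norm_exp : ∀ w, ‖Complex.exp (Complex.I * F w)‖ = Real.exp (-(F w).im) := fun w => by
    simp [Complex.norm_exp]
  have hexp : DiffContOnCl ℂ (fun w => Complex.exp (Complex.I * F w)) (Complex.im ⁻¹' Ioo a b) :=
    Complex.differentiable_exp.comp_diffContOnCl (hF.const_smul Complex.I)
  have hle : ‖Complex.exp (Complex.I * F z)‖ ≤ 1 := by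
    refine PhragmenLindelof.horizontal_strip
      (f := fun w => Complex.exp (Complex.I * F w)) hexp
      ⟨0, div_pos Real.pi_pos (sub_pos.2 hab), 0, ?_⟩ ?_ ?_ hz.1 hz.2
    · refine Asymptotics.IsBigO.of_bound (Real.exp M) ?_
      filter_upwards [Filter.mem_inf_of_right (Filter.mem_principal_self _)] with w hw
      rw [norm_exp]
      simpa using neg_le.1 (hM w hw)
    · intro w hw
      simpa [norm_exp] using ha w hw
    · intro w hw
      simpa [norm_exp] using hb w hw
  simpa [norm_exp] using hle

/-- Lemma inside Theorem 5.3 (Subsequence Convergence): if the bounded continuous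
pair `(f, g)` on the closed strip `ℝ × [0,1]` satisfies the Cauchy–Riemann system
`∂f/∂t = ∂g/∂τ`, `∂f/∂τ = -∂g/∂t` on the open strip (i.e. the one-form
`f dτ + g dt` is harmonic) and `f(τ,0) = f(τ,1) = 0` for all `τ`, then `f ≡ 0`
and `g` is a constant `b`, i.e. `f dτ + g dt = b dt`. -/
theorem strip_harmonic_one_form_with_legendrian_boundary_is_b_dt
    (f g : ℝ × ℝ → ℝ)
    (hfc : ContinuousOn f {p : ℝ × ℝ | p.2 ∈ Icc (0:ℝ) 1})
    (hgc : ContinuousOn g {p : ℝ × ℝ | p.2 ∈ Icc (0:ℝ) 1})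
    (hfb : ∃ M : ℝ, ∀ p ∈ {p : ℝ × ℝ | p.2 ∈ Icc (0:ℝ) 1}, |f p| ≤ M)
    (hgb : ∃ M : ℝ, ∀ p ∈ {p : ℝ × ℝ | p.2 ∈ Icc (0:ℝ) 1}, |g p| ≤ M)
    (hfd : DifferentiableOn ℝ f {p : ℝ × ℝ | p.2 ∈ Ioo (0:ℝ) 1})
    (hgd : DifferentiableOn ℝ g {p : ℝ × ℝ | p.2 ∈ Ioo (0:ℝ) 1})
    (hCR1 : ∀ p ∈ {p : ℝ × ℝ | p.2 ∈ Ioo (0:ℝ) 1},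
      deriv (fun t : ℝ => f (p.1, t)) p.2 = deriv (fun τ : ℝ => g (τ, p.2)) p.1)
    (hCR2 : ∀ p ∈ {p : ℝ × ℝ | p.2 ∈ Ioo (0:ℝ) 1},
      deriv (fun τ : ℝ => f (τ, p.2)) p.1 = - deriv (fun t : ℝ => g (p.1, t)) p.2)
    (hbc : ∀ τ : ℝ, f (τ, 0) = 0 ∧ f (τ, 1) = 0) :
    (∀ p ∈ {p : ℝ × ℝ | p.2 ∈ Icc (0:ℝ) 1}, f p = 0) ∧
      ∃ b : ℝ, ∀ p ∈ {p : ℝ × ℝ | p.2 ∈ Icc (0:ℝ) 1}, g p = b := by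
  obtain ⟨M, hM⟩ := hfb
  set F : ℂ → ℂ := fun z => ⟨g (z.re, z.im), f (z.re, z.im)⟩ with hFdef
  set U : Set ℂ := Complex.im ⁻¹' Ioo 0 1 with hU
  have hUo : IsOpen U := isOpen_Ioo.preimage Complex.continuous_im
  have hSo : IsOpen {p : ℝ × ℝ | p.2 ∈ Ioo (0:ℝ) 1} := isOpen_Ioo.preimage continuous_snd
  have hUc : closure U = Complex.im ⁻¹' Icc 0 1 := by
    rw [hU, Complex.closure_preimage_im, closure_Ioo zero_ne_one]
  have hFd : DifferentiableOn ℂ F U := fun z hz =>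
    (differentiableAt_complex_of_cauchyRiemann
      (hgd.differentiableAt (hSo.mem_nhds hz)) (hfd.differentiableAt (hSo.mem_nhds hz))
      (hCR1 (z.re, z.im) hz).symm (by rw [hCR2 (z.re, z.im) hz, neg_neg])).differentiableWithinAt
  have hFc : ContinuousOn F (closure U) := by
    have hmaps : MapsTo Complex.equivRealProdCLM (closure U)
        {p : ℝ × ℝ | p.2 ∈ Icc (0:ℝ) 1} := by
      rw [hUc]
      exact fun z hz => hz
    have hc := Complex.equivRealProdCLM.continuous.continuousOn (s := closure U)
    exact Complex.equivRealProdCLM.symm.continuous.comp_continuousOn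
      ((hgc.comp hc hmaps).prodMk (hfc.comp hc hmaps)) |>.congr fun z _ => by
        apply Complex.ext <;> simp [hFdef]
  have hF : DiffContOnCl ℂ F U := ⟨hFd, hFc⟩
  have hf0 : ∀ p ∈ {p : ℝ × ℝ | p.2 ∈ Icc (0:ℝ) 1}, f p = 0 := by
    rintro ⟨x, y⟩ hp
    have h0 : ∀ z : ℂ, z.im = 0 → f (z.re, z.im) = 0 := fun z hz => hz ▸ (hbc z.re).1
    have h1 : ∀ z : ℂ, z.im = 1 → f (z.re, z.im) = 0 := fun z hz => hz ▸ (hbc z.re).2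
    have hbound : ∀ z ∈ U, |f (z.re, z.im)| ≤ M := fun z hz =>
      hM (z.re, z.im) (Ioo_subset_Icc_self hz)
    apply le_antisymm
    · have := im_nonneg_of_horizontal_strip (M := M) zero_lt_one hF.neg
        (fun z hz => neg_le_neg (abs_le.1 (hbound z hz)).2)
        (fun z hz => by simp [hFdef, h0 z hz]) (fun z hz => by simp [hFdef, h1 z hz])
        (z := ⟨x, y⟩) hp
      simpa [hFdef] using this
    · exact im_nonneg_of_horizontal_strip (M := M) zero_lt_one hF
        (fun z hz => (abs_le.1 (hbound z hz)).1)
        (fun z hz => (h0 z hz).ge) (fun z hz => (h1 z hz).ge) (z := ⟨x, y⟩) hp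
  refine ⟨hf0, ?_⟩
  have hUconn : IsConnected U :=
    ⟨⟨⟨0, 1 / 2⟩, by norm_num [hU]⟩,
      ((convex_Ioo (0:ℝ) 1).linear_preimage Complex.imLm).isPreconnected⟩
  obtain ⟨c, hc⟩ := (hFd.analyticOnNhd hUo).eq_const_of_im_eq_const (c₀ := 0)
    (fun z hz => hf0 (z.re, z.im) (Ioo_subset_Icc_self hz)) hUo hUconn
  have hcl : EqOn F (fun _ => c) (closure U) :=
    EqOn.of_subset_closure hc hFc continuousOn_const subset_closure subset_rfl
  refine ⟨c.re, fun p hp => congrArg Complex.re (hcl (x := ⟨p.1, p.2⟩) ?_)⟩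
  rw [hUc]
  exact hp
end

section
/- For every A ≥ 0, B ≥ 0 and r₀ ∈ (0,1] there exist constants ε₀ > 0 and C > 0, depending only on A, B and r₀, with the following property. Let e be a nonnegative C² function on the open disc D(r₀) ⊂ ℝ² of radius r₀ centered at the origin satisfying the differential inequality Δe ≥ −(A e² + B e) pointwise on D(r₀), where Δ = ∂²/∂x² + ∂²/∂y² is the analysts' Laplacian. If ∫_{D(r₀)} e ≤ ε₀, then for every 0 < r ≤ r₀ and every σ ∈ (0, r] one has σ² · sup_{D(r−σ)} e ≤ C ∫_{D(r)} e; in particular, taking σ = r/2, sup_{D(r/2)} e ≤ 4C r⁻² ∫_{D(r)} e for all 0 < r ≤ r₀. -/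
open Set MeasureTheory

/-- The open disc of radius `r` centered at the origin in `ℝ²`. -/
def disc (r : ℝ) : Set (ℝ × ℝ) := {p : ℝ × ℝ | p.1 ^ 2 + p.2 ^ 2 < r ^ 2}

theorem hasDerivAt_intervalIntegral_of_continuous {F F' : ℝ → ℝ → ℝ}
    (hF : Continuous (Function.uncurry F)) (hF' : Continuous (Function.uncurry F'))
    (h : ∀ x t, HasDerivAt (fun y => F y t) (F' x t) x) (a b x : ℝ) :
    HasDerivAt (fun y => ∫ t in a..b, F y t) (∫ t in a..b, F' x t) x := by
  obtain ⟨M, hM⟩ := ((isCompact_Icc (a := x - 1) (b := x + 1)).prod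
    (isCompact_uIcc (a := a) (b := b))).exists_bound_of_continuousOn hF'.continuousOn
  have hc (y : ℝ) : Continuous (F y) := hF.comp (by fun_prop : Continuous fun t => (y, t))
  have hc' : Continuous (F' x) := hF'.comp (by fun_prop : Continuous fun t => (x, t))
  refine (intervalIntegral.hasDerivAt_integral_of_dominated_loc_of_deriv_le
    (s := Icc (x - 1) (x + 1)) (bound := fun _ => M)
    (Icc_mem_nhds (by linarith) (by linarith))
    (.of_forall fun y => (hc y).aestronglyMeasurable)
    ((hc x).intervalIntegrable _ _) hc'.aestronglyMeasurable
    (.of_forall fun t ht y hy => hM (y, t) ⟨hy, uIoc_subset_uIcc ht⟩)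
    intervalIntegrable_const (.of_forall fun t _ y _ => h y t)).2

/-- The point at distance `s` and angle `θ` from `p`. -/
noncomputable def polarPoint (p : ℝ × ℝ) (s θ : ℝ) : ℝ × ℝ :=
  (p.1 + s * Real.cos θ, p.2 + s * Real.sin θ)

theorem hasDerivAt_clm_along {D : ℝ × ℝ → ℝ × ℝ →L[ℝ] ℝ} (hD : Differentiable ℝ D)
    {γ v : ℝ → ℝ × ℝ} {γ' v' : ℝ × ℝ} {t : ℝ} (hγ : HasDerivAt γ γ' t) (hv : HasDerivAt v v' t) :
    HasDerivAt (fun t => D (γ t) (v t)) (fderiv ℝ D (γ t) γ' (v t) + D (γ t) v') t :=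
  ((hD _).hasFDerivAt.comp_hasDerivAt t hγ).clm_apply hv

/-- The Laplacian on `ℝ × ℝ`, as the trace of the second Fréchet derivative. -/
noncomputable def planeLaplacian (u : ℝ × ℝ → ℝ) (q : ℝ × ℝ) : ℝ :=
  fderiv ℝ (fderiv ℝ u) q (1, 0) (1, 0) + fderiv ℝ (fderiv ℝ u) q (0, 1) (0, 1)

theorem deriv_deriv_slices_eq_planeLaplacian {u : ℝ × ℝ → ℝ} (hu : ContDiff ℝ 2 u) (p : ℝ × ℝ) :
    deriv (deriv (fun x : ℝ => u (x, p.2))) p.1 + deriv (deriv (fun y : ℝ => u (p.1, y))) p.2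
      = planeLaplacian u p := by
  have hd : Differentiable ℝ u := hu.differentiable (by norm_num)
  have hd2 : Differentiable ℝ (fderiv ℝ u) :=
    (hu.fderiv_right (m := 1) (by norm_num)).differentiable (by norm_num)
  have hx (x y : ℝ) : HasDerivAt (fun x : ℝ => (x, y)) ((1 : ℝ), (0 : ℝ)) x :=
    (hasDerivAt_id x).prodMk (hasDerivAt_const x y)
  have hy (x y : ℝ) : HasDerivAt (fun y : ℝ => (x, y)) ((0 : ℝ), (1 : ℝ)) y :=
    (hasDerivAt_const y x).prodMk (hasDerivAt_id y)
  have h1 : deriv (fun x : ℝ => u (x, p.2)) = fun x => fderiv ℝ u (x, p.2) (1, 0) :=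
    funext fun x => ((hd _).hasFDerivAt.comp_hasDerivAt x (hx x p.2)).deriv
  have h2 : deriv (fun y : ℝ => u (p.1, y)) = fun y => fderiv ℝ u (p.1, y) (0, 1) :=
    funext fun y => ((hd _).hasFDerivAt.comp_hasDerivAt y (hy p.1 y)).deriv
  rw [h1, h2, planeLaplacian]
  congr 1
  · have := hasDerivAt_clm_along hd2 (hx p.1 p.2) (hasDerivAt_const p.1 ((1 : ℝ), (0 : ℝ)))
    rw [this.deriv, map_zero, add_zero]
  · have := hasDerivAt_clm_along hd2 (hy p.1 p.2) (hasDerivAt_const p.2 ((0 : ℝ), (1 : ℝ)))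
    rw [this.deriv, map_zero, add_zero]

section MeanValue

open Real

theorem hasDerivAt_polarPoint_radius (p : ℝ × ℝ) (s θ : ℝ) :
    HasDerivAt (fun s => polarPoint p s θ) (cos θ, sin θ) s := by
  have h (a c : ℝ) : HasDerivAt (fun s => a + s * c) c s := by
    simpa using ((hasDerivAt_id s).mul_const c).const_add a
  exact (h _ _).prodMk (h _ _)

theorem hasDerivAt_polarPoint_angle (p : ℝ × ℝ) (s θ : ℝ) :
    HasDerivAt (fun θ => polarPoint p s θ) (s • (-sin θ, cos θ)) θ :=
  (((hasDerivAt_cos θ).const_mul s).const_add p.1).prodMk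
    (((hasDerivAt_sin θ).const_mul s).const_add p.2)

theorem polar_trace_bilinear (D : ℝ × ℝ →L[ℝ] ℝ × ℝ →L[ℝ] ℝ) (θ : ℝ) :
    D (cos θ, sin θ) (cos θ, sin θ) + D (-sin θ, cos θ) (-sin θ, cos θ)
      = D (1, 0) (1, 0) + D (0, 1) (0, 1) := by
  have h (a b : ℝ) : ((a, b) : ℝ × ℝ) = a • (1, 0) + b • (0, 1) := by simp
  rw [h (cos θ), h (-sin θ)]
  simp only [map_add, map_smul, add_apply, smul_apply,
    smul_eq_mul]
  linear_combination (D (1, 0) (1, 0) + D (0, 1) (0, 1)) * sin_sq_add_cos_sq θ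

@[fun_prop]
theorem continuous_polarPoint (p : ℝ × ℝ) :
    Continuous fun x : ℝ × ℝ => polarPoint p x.1 x.2 := by
  unfold polarPoint; fun_prop

theorem hasDerivAt_radial_flux {u : ℝ × ℝ → ℝ} (hu : ContDiff ℝ 2 u) (p : ℝ × ℝ) (s : ℝ) :
    HasDerivAt (fun s => ∫ θ in -π..π, s * fderiv ℝ u (polarPoint p s θ) (cos θ, sin θ))
      (∫ θ in -π..π, s * planeLaplacian u (polarPoint p s θ)) s := by
  have hc1 : Continuous (fderiv ℝ u) := hu.continuous_fderiv (by norm_num)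
  have hd : ContDiff ℝ 1 (fderiv ℝ u) := hu.fderiv_right (by norm_num)
  have hd2 : Differentiable ℝ (fderiv ℝ u) := hd.differentiable (by norm_num)
  have hc2 : Continuous (fderiv ℝ (fderiv ℝ u)) := hd.continuous_fderiv (by norm_num)
  have hps : Continuous fun θ => polarPoint p s θ := by unfold polarPoint; fun_prop
  have key := hasDerivAt_intervalIntegral_of_continuous
    (F := fun s θ => s * fderiv ℝ u (polarPoint p s θ) (cos θ, sin θ))
    (F' := fun s θ => fderiv ℝ u (polarPoint p s θ) (cos θ, sin θ)
      + s * fderiv ℝ (fderiv ℝ u) (polarPoint p s θ) (cos θ, sin θ) (cos θ, sin θ))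
    (by unfold Function.uncurry; fun_prop) (by unfold Function.uncurry; fun_prop)
    (fun s θ => by
      have := hasDerivAt_clm_along hd2 (hasDerivAt_polarPoint_radius p s θ)
        (hasDerivAt_const s (cos θ, sin θ))
      exact ((hasDerivAt_id s).fun_mul this).congr_deriv (by simp)) (-π) π s
  refine key.congr_deriv (Eq.symm ?_)
  have hθ (θ : ℝ) : HasDerivAt (fun θ => fderiv ℝ u (polarPoint p s θ) (-sin θ, cos θ))
      (s * fderiv ℝ (fderiv ℝ u) (polarPoint p s θ) (-sin θ, cos θ) (-sin θ, cos θ)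
        - fderiv ℝ u (polarPoint p s θ) (cos θ, sin θ)) θ := by
    have hv : HasDerivAt (fun θ => (-sin θ, cos θ)) (-(cos θ, sin θ)) θ :=
      (hasDerivAt_sin θ).neg.prodMk (hasDerivAt_cos θ)
    refine (hasDerivAt_clm_along hd2 (hasDerivAt_polarPoint_angle p s θ) hv).congr_deriv ?_
    rw [map_neg, map_smul, smul_apply, smul_eq_mul, sub_eq_add_neg]
  have hint := intervalIntegral.integral_eq_sub_of_hasDerivAt (a := -π) (b := π)
    (fun θ _ => hθ θ) (Continuous.intervalIntegrable (by fun_prop) _ _)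
  have hzero : fderiv ℝ u (polarPoint p s π) (-sin π, cos π)
      - fderiv ℝ u (polarPoint p s (-π)) (-sin (-π), cos (-π)) = 0 := by
    simp [polarPoint]
  rw [hzero] at hint
  rw [← add_zero (∫ θ in -π..π, _ + _), ← hint, ← intervalIntegral.integral_add
    (Continuous.intervalIntegrable (by fun_prop) _ _)
    (Continuous.intervalIntegrable (by fun_prop) _ _)]
  refine intervalIntegral.integral_congr fun θ _ => ?_
  have := polar_trace_bilinear (fderiv ℝ (fderiv ℝ u) (polarPoint p s θ)) θ
  simp only [planeLaplacian]
  linear_combination -s * this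

theorem hasDerivAt_circle_integral {u : ℝ × ℝ → ℝ} (hu : ContDiff ℝ 2 u) (p : ℝ × ℝ) (s : ℝ) :
    HasDerivAt (fun s => ∫ θ in -π..π, u (polarPoint p s θ))
      (∫ θ in -π..π, fderiv ℝ u (polarPoint p s θ) (cos θ, sin θ)) s := by
  have hc0 : Continuous u := hu.continuous
  have hc1 : Continuous (fderiv ℝ u) := hu.continuous_fderiv (by norm_num)
  have hd : Differentiable ℝ u := hu.differentiable (by norm_num)
  exact hasDerivAt_intervalIntegral_of_continuous
    (F := fun s θ => u (polarPoint p s θ))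
    (F' := fun s θ => fderiv ℝ u (polarPoint p s θ) (cos θ, sin θ))
    (by unfold Function.uncurry; fun_prop) (by unfold Function.uncurry; fun_prop)
    (fun s θ => (hd _).hasFDerivAt.comp_hasDerivAt s (hasDerivAt_polarPoint_radius p s θ)) (-π) π s

/-- Lower bound for circle integrals of a function whose Laplacian is bounded below. -/
theorem circle_integral_ge {u : ℝ × ℝ → ℝ} (hu : ContDiff ℝ 2 u) (p : ℝ × ℝ) {L ρ : ℝ}
    (hL : ∀ s ∈ Ioo 0 ρ, ∀ θ, -L ≤ planeLaplacian u (polarPoint p s θ))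
    {s : ℝ} (hs : s ∈ Icc 0 ρ) :
    2 * π * u p - π * L * s ^ 2 / 2 ≤ ∫ θ in -π..π, u (polarPoint p s θ) := by
  have hρ : (0 : ℝ) ∈ Icc 0 ρ := ⟨le_rfl, hs.1.trans hs.2⟩
  set F : ℝ → ℝ := fun s => ∫ θ in -π..π, s * fderiv ℝ u (polarPoint p s θ) (cos θ, sin θ)
  have hF (t : ℝ) : HasDerivAt (fun s => F s + π * L * s ^ 2)
      ((∫ θ in -π..π, t * planeLaplacian u (polarPoint p t θ)) + π * L * (2 * t)) t := by
    exact ((hasDerivAt_radial_flux hu p t).fun_add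
      ((hasDerivAt_pow 2 t).const_mul (π * L))).congr_deriv (by simp)
  have hFmono : MonotoneOn (fun s => F s + π * L * s ^ 2) (Icc 0 ρ) := by
    refine monotoneOn_of_deriv_nonneg (convex_Icc 0 ρ)
      (fun t _ => (hF t).continuousAt.continuousWithinAt)
      (fun t _ => (hF t).differentiableAt.differentiableWithinAt) fun t ht => ?_
    rw [interior_Icc] at ht
    rw [(hF t).deriv]
    have hcl : Continuous fun θ => planeLaplacian u (polarPoint p t θ) := by
      have hc2 : Continuous (fderiv ℝ (fderiv ℝ u)) :=
        (hu.fderiv_right (m := 1) (by norm_num)).continuous_fderiv (by norm_num)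
      have hps : Continuous fun θ => polarPoint p t θ := by unfold polarPoint; fun_prop
      unfold planeLaplacian; fun_prop
    have := intervalIntegral.integral_mono_on (μ := volume) (a := -π) (b := π) (by linarith [pi_pos])
      (intervalIntegrable_const (c := t * -L)) ((hcl.const_mul t).intervalIntegrable _ _)
      fun θ _ => mul_le_mul_of_nonneg_left (hL t ht θ) ht.1.le
    rw [intervalIntegral.integral_const, smul_eq_mul] at this
    linarith
  have hF0 : F 0 = 0 := by simp [F]
  have hH (t : ℝ) : HasDerivAt
      (fun s => (∫ θ in -π..π, u (polarPoint p s θ)) + π * L / 2 * s ^ 2)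
      ((∫ θ in -π..π, fderiv ℝ u (polarPoint p t θ) (cos θ, sin θ)) + π * L / 2 * (2 * t)) t := by
    exact ((hasDerivAt_circle_integral hu p t).fun_add
      ((hasDerivAt_pow 2 t).const_mul (π * L / 2))).congr_deriv (by simp)
  have hHmono : MonotoneOn
      (fun s => (∫ θ in -π..π, u (polarPoint p s θ)) + π * L / 2 * s ^ 2) (Icc 0 ρ) := by
    refine monotoneOn_of_deriv_nonneg (convex_Icc 0 ρ)
      (fun t _ => (hH t).continuousAt.continuousWithinAt)
      (fun t _ => (hH t).differentiableAt.differentiableWithinAt) fun t ht => ?_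
    rw [interior_Icc] at ht
    rw [(hH t).deriv]
    have h1 := hFmono hρ (Ioo_subset_Icc_self ht) ht.1.le
    simp only [F, intervalIntegral.integral_const_mul] at h1
    refine nonneg_of_mul_nonneg_right (a := t) ?_ ht.1
    nlinarith
  have h2 := hHmono hρ hs hs.1
  have h3 : (∫ θ in -π..π, u (polarPoint p 0 θ)) = 2 * π * u p := by
    simp only [polarPoint, zero_mul, add_zero, intervalIntegral.integral_const, smul_eq_mul]
    ring
  simp only [h3] at h2
  linarith

/-- Mean value inequality on a disc for a function whose Laplacian is bounded below. -/
theorem mean_value_ineq {u : ℝ × ℝ → ℝ} (hu : ContDiff ℝ 2 u) (p : ℝ × ℝ) {L ρ : ℝ}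
    (hρ : 0 < ρ) (hL : ∀ s ∈ Ioo 0 ρ, ∀ θ, -L ≤ planeLaplacian u (polarPoint p s θ)) :
    π * ρ ^ 2 * u p - π * L * ρ ^ 4 / 8
      ≤ ∫ q in {q : ℝ × ℝ | (q.1 - p.1) ^ 2 + (q.2 - p.2) ^ 2 < ρ ^ 2}, u q := by
  have hc0 : Continuous u := hu.continuous
  have hmeas : MeasurableSet {q : ℝ × ℝ | (q.1 - p.1) ^ 2 + (q.2 - p.2) ^ 2 < ρ ^ 2} :=
    (isOpen_lt (by fun_prop) (by fun_prop)).measurableSet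
  have hpolar : (∫ q in {q : ℝ × ℝ | (q.1 - p.1) ^ 2 + (q.2 - p.2) ^ 2 < ρ ^ 2}, u q)
      = ∫ x in Ioo 0 ρ ×ˢ Ioo (-π) π, x.1 * u (polarPoint p x.1 x.2) := by
    rw [← integral_indicator hmeas, ← integral_add_left_eq_self _ p,
      ← integral_comp_polarCoord_symm, ← integral_indicator (s := polarCoord.target)
        (measurableSet_Ioi.prod measurableSet_Ioo),
      ← integral_indicator (measurableSet_Ioo.prod measurableSet_Ioo)]
    congr 1
    ext ⟨s, θ⟩
    by_cases hs : 0 < s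
    · by_cases hθ : θ ∈ Ioo (-π) π
      · have h1 : (s * cos θ) ^ 2 + (s * sin θ) ^ 2 < ρ ^ 2 ↔ s < ρ := by
          rw [show (s * cos θ) ^ 2 + (s * sin θ) ^ 2 = s ^ 2 by
            linear_combination s ^ 2 * sin_sq_add_cos_sq θ]
          exact pow_lt_pow_iff_left₀ hs.le hρ.le (by norm_num)
        by_cases hsρ : s < ρ <;>
        simp [indicator, hs, hθ.1, hθ.2, hsρ, h1, polarPoint, Prod.add_def]
      · have : (s, θ) ∉ polarCoord.target := fun h => hθ h.2
        rw [indicator_of_notMem this, indicator_of_notMem (fun h => hθ h.2)]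
    · have : (s, θ) ∉ polarCoord.target := fun h => hs h.1
      rw [indicator_of_notMem this, indicator_of_notMem (fun h => hs h.1.1)]
  have hcont : Continuous fun x : ℝ × ℝ => x.1 * u (polarPoint p x.1 x.2) := by fun_prop
  have hion : IntegrableOn (fun x : ℝ × ℝ => x.1 * u (polarPoint p x.1 x.2))
      (Ioo 0 ρ ×ˢ Ioo (-π) π) (volume.prod volume) :=
    (hcont.continuousOn.integrableOn_compact
      ((isCompact_Icc (a := 0) (b := ρ)).prod (isCompact_Icc (a := -π) (b := π)))).mono_set
      (prod_mono Ioo_subset_Icc_self Ioo_subset_Icc_self)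
  rw [hpolar, Measure.volume_eq_prod, setIntegral_prod _ hion]
  have hinner (s : ℝ) : (∫ θ in Ioo (-π) π, s * u (polarPoint p s θ))
      = s * ∫ θ in -π..π, u (polarPoint p s θ) := by
    rw [← integral_Ioc_eq_integral_Ioo, ← intervalIntegral.integral_of_le (by linarith [pi_pos]),
      intervalIntegral.integral_const_mul]
  simp only [hinner]
  rw [← integral_Ioc_eq_integral_Ioo, ← intervalIntegral.integral_of_le hρ.le]
  have hHc : Continuous fun s => ∫ θ in -π..π, u (polarPoint p s θ) :=
    continuous_iff_continuousAt.2 fun s => (hasDerivAt_circle_integral hu p s).continuousAt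
  have hlow : (∫ s in 0..ρ, s * (2 * π * u p - π * L * s ^ 2 / 2))
      ≤ ∫ s in 0..ρ, s * ∫ θ in -π..π, u (polarPoint p s θ) :=
    intervalIntegral.integral_mono_on hρ.le (Continuous.intervalIntegrable (by fun_prop) _ _)
      (Continuous.intervalIntegrable (by fun_prop) _ _)
      fun s hs => mul_le_mul_of_nonneg_left (circle_integral_ge hu p hL hs) hs.1
  refine le_trans (le_of_eq ?_) hlow
  have hd (s : ℝ) : HasDerivAt (fun s => π * u p * s ^ 2 - π * L / 8 * s ^ 4)
      (s * (2 * π * u p - π * L * s ^ 2 / 2)) s := by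
    refine (((hasDerivAt_pow 2 s).const_mul (π * u p)).fun_sub
      ((hasDerivAt_pow 4 s).const_mul (π * L / 8))).congr_deriv ?_
    push_cast; ring
  rw [intervalIntegral.integral_eq_sub_of_hasDerivAt (fun s _ => hd s)
    (Continuous.intervalIntegrable (by fun_prop) _ _)]
  ring

end MeanValue

section Radius

/-- The Euclidean distance from `p` to the origin in `ℝ²`. -/
noncomputable def radius (p : ℝ × ℝ) : ℝ := √(p.1 ^ 2 + p.2 ^ 2)

theorem radius_nonneg (p : ℝ × ℝ) : 0 ≤ radius p := Real.sqrt_nonneg _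

@[fun_prop]
theorem continuous_radius : Continuous radius := by unfold radius; fun_prop

theorem mem_disc_iff {R : ℝ} (hR : 0 < R) {p : ℝ × ℝ} : p ∈ disc R ↔ radius p < R :=
  (Real.sqrt_lt' hR).symm

theorem radius_eq_norm (p : ℝ × ℝ) : radius p = ‖(⟨p.1, p.2⟩ : ℂ)‖ := by
  rw [Complex.norm_eq_sqrt_sq_add_sq, radius]

theorem radius_add_le (p q : ℝ × ℝ) : radius (p + q) ≤ radius p + radius q := by
  simp only [radius_eq_norm]
  exact norm_add_le (⟨p.1, p.2⟩ : ℂ) ⟨q.1, q.2⟩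

theorem radius_polarPoint_le (p : ℝ × ℝ) {s : ℝ} (hs : 0 ≤ s) (θ : ℝ) :
    radius (polarPoint p s θ) ≤ radius p + s := by
  have h : radius (s * Real.cos θ, s * Real.sin θ) = s := by
    rw [radius, show (s * Real.cos θ) ^ 2 + (s * Real.sin θ) ^ 2 = s ^ 2 by
      linear_combination s ^ 2 * Real.sin_sq_add_cos_sq θ, Real.sqrt_sq hs]
  exact (radius_add_le p (s * Real.cos θ, s * Real.sin θ)).trans_eq (by rw [h])

theorem isOpen_disc (R : ℝ) : IsOpen (disc R) := isOpen_lt (by fun_prop) (by fun_prop)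

theorem disc_subset_disc {R R' : ℝ} (hR : 0 ≤ R) (h : R ≤ R') : disc R ⊆ disc R' :=
  fun _ hp => lt_of_lt_of_le hp (pow_le_pow_left₀ hR h 2)

theorem isCompact_radius_le (R : ℝ) : IsCompact {p : ℝ × ℝ | radius p ≤ R} := by
  refine ((isCompact_Icc (a := -R) (b := R)).prod
    (isCompact_Icc (a := -R) (b := R))).of_isClosed_subset
    (isClosed_le continuous_radius continuous_const) fun p hp => ?_
  have h1 : |p.1| ≤ radius p := Real.abs_le_sqrt (by nlinarith [sq_nonneg p.2])
  have h2 : |p.2| ≤ radius p := Real.abs_le_sqrt (by nlinarith [sq_nonneg p.1])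
  exact ⟨abs_le.1 (h1.trans hp), abs_le.1 (h2.trans hp)⟩

end Radius

theorem integrableOn_disc {u : ℝ × ℝ → ℝ} (hu : Continuous u) {R : ℝ} (hR : 0 < R) :
    IntegrableOn u (disc R) :=
  (hu.continuousOn.integrableOn_compact (isCompact_radius_le R)).mono_set
    fun _ hp => ((mem_disc_iff hR).1 hp).le

/-- Schoen's interior estimate for globally defined `C²` functions. -/
theorem schoen_estimate {A B R : ℝ} (hA : 0 ≤ A) (hB : 0 ≤ B) (hR : 0 < R) (hR1 : R ≤ 1)
    {u : ℝ × ℝ → ℝ} (hu : ContDiff ℝ 2 u) (hu0 : ∀ p, 0 ≤ u p)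
    (hΔ : ∀ p ∈ disc R, -(A * u p ^ 2 + B * u p) ≤ planeLaplacian u p)
    (hsmall : 8 * A * (∫ q in disc R, u q) ≤ 1) {p : ℝ × ℝ} (hp : p ∈ disc R) :
    (R - radius p) ^ 2 * u p ≤ (8 + 4 * B) * ∫ q in disc R, u q := by
  have hc : Continuous u := hu.continuous
  have hint : IntegrableOn u (disc R) := integrableOn_disc hc hR
  set I := ∫ q in disc R, u q
  have hI : 0 ≤ I := integral_nonneg hu0
  have hp' := (mem_disc_iff hR).1 hp
  obtain ⟨p₀, hp₀, hmax⟩ := (isCompact_radius_le R).exists_isMaxOn ⟨p, hp'.le⟩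
    (f := fun q => (R - radius q) ^ 2 * u q) (by fun_prop)
  refine (hmax (a := p) hp'.le).trans ?_
  set d := R - radius p₀ with hdR
  change d ^ 2 * u p₀ ≤ _
  have hd0 : 0 ≤ d := sub_nonneg.2 hp₀
  clear_value d
  rcases hd0.eq_or_lt with hd | hd
  · rw [← hd]; nlinarith [mul_nonneg hB hI]
  have hd1 : d ≤ 1 := by linarith [radius_nonneg p₀]
  have he : 0 ≤ u p₀ := hu0 p₀
  set K := 16 * A * u p₀ + 4 * B
  have hK : 0 ≤ K := by positivity
  have hball {ρ : ℝ} (hρ : 0 < ρ) (hρd : ρ ≤ d / 2) :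
      Real.pi * ρ ^ 2 * u p₀ - Real.pi * (K * u p₀) * ρ ^ 4 / 8 ≤ I := by
    refine (mean_value_ineq hu p₀ hρ fun s hs θ => ?_).trans
      (setIntegral_mono_set hint (.of_forall hu0) (LE.le.eventuallyLE fun q hq => ?_))
    · have hq := radius_polarPoint_le p₀ hs.1.le θ
      set q := polarPoint p₀ s θ
      have hqd : d / 2 ≤ R - radius q := by linarith [hs.2]
      have hq' : radius q < R := by linarith
      have h1 : (R - radius q) ^ 2 * u q ≤ d ^ 2 * u p₀ := hdR ▸ hmax (a := q) hq'.le
      have h2 : (d / 2) ^ 2 * u q ≤ (R - radius q) ^ 2 * u q :=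
        mul_le_mul_of_nonneg_right (pow_le_pow_left₀ (by positivity) hqd 2) (hu0 q)
      have h3 : u q ≤ 4 * u p₀ := by
        refine le_of_mul_le_mul_left (a := d ^ 2) ?_ (by positivity)
        linarith
      have h4 : A * u q ^ 2 ≤ A * (4 * u p₀) ^ 2 :=
        mul_le_mul_of_nonneg_left (pow_le_pow_left₀ (hu0 q) h3 2) hA
      have h5 : B * u q ≤ B * (4 * u p₀) := mul_le_mul_of_nonneg_left h3 hB
      refine le_trans ?_ (hΔ q ((mem_disc_iff hR).2 hq'))
      simp only [K]
      linarith
    · have h1 : radius (q - p₀) < ρ := (Real.sqrt_lt' hρ).2 hq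
      have h2 := radius_add_le p₀ (q - p₀)
      rw [add_sub_cancel] at h2
      exact (mem_disc_iff hR).2 (by linarith)
  have hπ := Real.pi_gt_three
  rcases le_or_gt (K * d ^ 2) 16 with hKd | hKd
  · have h1 := hball (half_pos hd) le_rfl
    have h2 : d ^ 2 * u p₀ * (K * d ^ 2) ≤ d ^ 2 * u p₀ * 16 :=
      mul_le_mul_of_nonneg_left hKd (by positivity)
    have h3 : Real.pi * (d ^ 2 * u p₀) ≤ 8 * I := by
      have := mul_le_mul_of_nonneg_left h2 Real.pi_pos.le
      linarith
    have h4 : 0 ≤ d ^ 2 * u p₀ := by positivity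
    nlinarith [mul_nonneg hB hI]
  · have hKpos : 0 < K := by
      rcases hK.eq_or_lt with h | h
      · rw [← h] at hKd; linarith
      · exact h
    have hsq : (2 / √K) ^ 2 = 4 / K := by rw [div_pow, Real.sq_sqrt hK]; norm_num
    have hle : 2 / √K ≤ d / 2 := by
      refine le_of_sq_le_sq ?_ (by positivity)
      rw [hsq, div_le_iff₀ hKpos]
      linarith
    have h1 := hball (by positivity) hle
    rw [show (2 / √K) ^ 4 = ((2 / √K) ^ 2) ^ 2 by ring, hsq] at h1
    have h2 : 2 * Real.pi * u p₀ ≤ K * I := by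
      have := mul_le_mul_of_nonneg_left h1 hK
      refine le_trans (le_of_eq ?_) this
      field_simp
      ring
    have h3 : 8 * A * I * u p₀ ≤ 1 * u p₀ := mul_le_mul_of_nonneg_right hsmall he
    have h4 : u p₀ ≤ 4 * B * I := by
      have : K * I = 2 * (8 * A * I * u p₀) + 4 * B * I := by simp only [K]; ring
      nlinarith
    have h5 : d ^ 2 * u p₀ ≤ 1 * u p₀ :=
      mul_le_mul_of_nonneg_right (pow_le_one₀ hd.le hd1) he
    linarith

/-- A nonnegative `C²` function on a disc agrees on each smaller disc with a nonnegative
`C²` function on the plane. -/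
theorem exists_contDiff_eqOn_disc {R R' : ℝ} (hR : 0 < R) (hRR' : R < R') {e : ℝ × ℝ → ℝ}
    (he : ContDiffOn ℝ 2 e (disc R')) (he0 : ∀ p ∈ disc R', 0 ≤ e p) :
    ∃ u : ℝ × ℝ → ℝ, ContDiff ℝ 2 u ∧ (∀ p, 0 ≤ u p) ∧ EqOn u e (disc R) := by
  have hsq : R ^ 2 < R' ^ 2 := pow_lt_pow_left₀ hRR' hR.le (by norm_num)
  set b := (R ^ 2 + R' ^ 2) / 2
  have hb : b = (R ^ 2 + R' ^ 2) / 2 := rfl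
  set χ : ℝ × ℝ → ℝ := fun p => Real.smoothTransition ((b - (p.1 ^ 2 + p.2 ^ 2)) / (b - R ^ 2))
  have hχ : ContDiff ℝ 2 χ := Real.smoothTransition.contDiff.comp (by fun_prop)
  have hχ0 {p : ℝ × ℝ} (hp : b < p.1 ^ 2 + p.2 ^ 2) : χ p = 0 :=
    Real.smoothTransition.zero_of_nonpos
      (div_nonpos_of_nonpos_of_nonneg (by linarith) (by linarith))
  refine ⟨fun p => χ p * e p, contDiff_iff_contDiffAt.2 fun p => ?_, fun p => ?_, fun p hp => ?_⟩
  · by_cases hp : p ∈ disc R'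
    · exact hχ.contDiffAt.mul (he.contDiffAt ((isOpen_disc R').mem_nhds hp))
    · have hbp : b < p.1 ^ 2 + p.2 ^ 2 := by
        have : R' ^ 2 ≤ p.1 ^ 2 + p.2 ^ 2 := not_lt.1 hp
        linarith
      have hev : ∀ᶠ q : ℝ × ℝ in nhds p, b < q.1 ^ 2 + q.2 ^ 2 :=
        (isOpen_lt continuous_const (by fun_prop)).mem_nhds hbp
      exact (contDiffAt_const (c := (0 : ℝ))).congr_of_eventuallyEq
        (hev.mono fun q hq => by simp [hχ0 hq])
  · by_cases hp : p ∈ disc R'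
    · exact mul_nonneg (Real.smoothTransition.nonneg _) (he0 p hp)
    · have : R' ^ 2 ≤ p.1 ^ 2 + p.2 ^ 2 := not_lt.1 hp
      simp [hχ0 (show b < p.1 ^ 2 + p.2 ^ 2 by linarith)]
  · have hp : p.1 ^ 2 + p.2 ^ 2 < R ^ 2 := hp
    have : χ p = 1 := Real.smoothTransition.one_of_one_le
      ((one_le_div (by linarith)).2 (by linarith))
    simp [this]

theorem planeLaplacian_eq_of_eqOn {u e : ℝ × ℝ → ℝ} (hu : ContDiff ℝ 2 u) {s : Set (ℝ × ℝ)}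
    (hs : IsOpen s) (h : EqOn u e s) {p : ℝ × ℝ} (hp : p ∈ s) :
    planeLaplacian u p = deriv (deriv (fun x : ℝ => e (x, p.2))) p.1
      + deriv (deriv (fun y : ℝ => e (p.1, y))) p.2 := by
  have hue : ∀ᶠ q in nhds p, u q = e q := h.eventuallyEq_of_mem (hs.mem_nhds hp)
  have h1 : (fun x : ℝ => u (x, p.2)) =ᶠ[nhds p.1] fun x => e (x, p.2) :=
    (show Continuous fun x : ℝ => (x, p.2) by fun_prop).continuousAt.eventually hue
  have h2 : (fun y : ℝ => u (p.1, y)) =ᶠ[nhds p.2] fun y => e (p.1, y) :=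
    (show Continuous fun y : ℝ => (p.1, y) by fun_prop).continuousAt.eventually hue
  rw [← deriv_deriv_slices_eq_planeLaplacian hu, h1.deriv.deriv_eq, h2.deriv.deriv_eq]

/-- The interior density estimate at a point of `D(r - σ)`, with an explicit constant. -/
theorem density_estimate_at_point {A B r₀ ε : ℝ} (hA : 0 ≤ A) (hB : 0 ≤ B)
    (hr₀ : r₀ ≤ 1) (hε0 : 0 ≤ ε) (hε : 8 * A * ε ≤ 1) {e : ℝ × ℝ → ℝ}
    (he : ContDiffOn ℝ 2 e (disc r₀)) (he0 : ∀ p ∈ disc r₀, 0 ≤ e p)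
    (hΔ : ∀ p ∈ disc r₀, -(A * e p ^ 2 + B * e p) ≤
      deriv (deriv (fun x : ℝ => e (x, p.2))) p.1
        + deriv (deriv (fun y : ℝ => e (p.1, y))) p.2)
    (hint : (∫⁻ p in disc r₀, ENNReal.ofReal (e p)) ≤ ENNReal.ofReal ε)
    {r σ : ℝ} (hr : r ≤ r₀) (hσ : σ ∈ Ioc 0 r) {p : ℝ × ℝ} (hp : p ∈ disc (r - σ)) :
    ENNReal.ofReal (σ ^ 2 * e p)
      ≤ ENNReal.ofReal (8 + 4 * B) * ∫⁻ q in disc r, ENNReal.ofReal (e q) := by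
  have hpr : radius p < r - σ := by
    rw [radius, ← Real.sqrt_sq (sub_nonneg.2 hσ.2)]
    exact Real.sqrt_lt_sqrt (by positivity) hp
  have hp0 := radius_nonneg p
  have hσ0 := hσ.1
  obtain ⟨R, hpR, hRr⟩ := exists_between (lt_sub_iff_add_lt.1 hpr)
  have hR : 0 < R := by linarith
  have hpd : p ∈ disc R := (mem_disc_iff hR).2 (by linarith)
  have hsub : disc R ⊆ disc r₀ := disc_subset_disc hR.le (by linarith)
  obtain ⟨u, hu, hu0, hue⟩ := exists_contDiff_eqOn_disc hR (hRr.trans_le hr) he he0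
  have hI : ENNReal.ofReal (∫ q in disc R, u q) = ∫⁻ q in disc R, ENNReal.ofReal (e q) := by
    rw [ofReal_integral_eq_lintegral_ofReal (integrableOn_disc hu.continuous hR) (.of_forall hu0)]
    exact setLIntegral_congr_fun (isOpen_disc R).measurableSet fun q hq => by rw [hue hq]
  have hIε : (∫ q in disc R, u q) ≤ ε := by
    rw [← ENNReal.ofReal_le_ofReal_iff hε0, hI]
    exact (lintegral_mono_set hsub).trans hint
  have key := schoen_estimate hA hB hR (by linarith) hu hu0
    (fun q hq => by
      rw [planeLaplacian_eq_of_eqOn hu (isOpen_disc R) hue hq, hue hq]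
      exact hΔ q (hsub hq))
    ((mul_le_mul_of_nonneg_left hIε (by positivity)).trans hε) hpd
  have hσR : σ ^ 2 * u p ≤ (R - radius p) ^ 2 * u p :=
    mul_le_mul_of_nonneg_right (pow_le_pow_left₀ hσ0.le (by linarith) 2) (hu0 p)
  rw [← hue hpd]
  refine (ENNReal.ofReal_le_ofReal (hσR.trans key)).trans ?_
  rw [ENNReal.ofReal_mul (by positivity), hI]
  gcongr
  exact disc_subset_disc hR.le hRr.le

/-- ε-regularity / interior density estimate (Theorem 3.2, via Schoen's argument):
for `A, B ≥ 0` and `r₀ ∈ (0,1]` there are `ε₀, C > 0` such that every nonnegative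
`C²` function `e` on `D(r₀)` satisfying `Δe ≥ -(A e² + B e)` and `∫_{D(r₀)} e ≤ ε₀`
obeys `σ² · sup_{D(r-σ)} e ≤ C ∫_{D(r)} e` for all `0 < σ ≤ r ≤ r₀`; in particular
`sup_{D(r/2)} e ≤ 4 C r⁻² ∫_{D(r)} e`. -/
theorem eps_regularity_density_estimate
    (A B : ℝ) (hA : 0 ≤ A) (hB : 0 ≤ B) (r₀ : ℝ) (hr₀ : r₀ ∈ Ioc (0:ℝ) 1) :
    ∃ ε₀ > (0:ℝ), ∃ C > (0:ℝ), ∀ e : ℝ × ℝ → ℝ,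
      ContDiffOn ℝ 2 e (disc r₀) →
      (∀ p ∈ disc r₀, 0 ≤ e p) →
      (∀ p ∈ disc r₀,
        -(A * e p ^ 2 + B * e p) ≤
          deriv (deriv (fun x : ℝ => e (x, p.2))) p.1
            + deriv (deriv (fun y : ℝ => e (p.1, y))) p.2) →
      (∫⁻ p in disc r₀, ENNReal.ofReal (e p)) ≤ ENNReal.ofReal ε₀ →
      (∀ r ∈ Ioc (0:ℝ) r₀, ∀ σ ∈ Ioc (0:ℝ) r, ∀ p ∈ disc (r - σ),
          ENNReal.ofReal (σ ^ 2 * e p)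
            ≤ ENNReal.ofReal C * ∫⁻ q in disc r, ENNReal.ofReal (e q)) ∧
        (∀ r ∈ Ioc (0:ℝ) r₀, ∀ p ∈ disc (r / 2),
          ENNReal.ofReal (e p)
            ≤ ENNReal.ofReal (4 * C / r ^ 2) * ∫⁻ q in disc r, ENNReal.ofReal (e q)) := by
  have h (e : ℝ × ℝ → ℝ) := @density_estimate_at_point A B r₀ (1 / (8 * A + 1)) hA hB hr₀.2
    (by positivity) (by rw [mul_one_div, div_le_one (by positivity)]; linarith) e
  refine ⟨1 / (8 * A + 1), by positivity, 8 + 4 * B, by positivity,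
    fun e he he0 hΔ hint => ⟨fun r hr σ hσ p hp => h e he he0 hΔ hint hr.2 hσ hp,
      fun r hr p hp => ?_⟩⟩
  have hr0 := hr.1
  have key := h e he he0 hΔ hint hr.2 (σ := r / 2) (p := p) ⟨by linarith, by linarith⟩
    (by rwa [sub_half])
  calc ENNReal.ofReal (e p)
      = ENNReal.ofReal (4 / r ^ 2) * ENNReal.ofReal ((r / 2) ^ 2 * e p) := by
        rw [← ENNReal.ofReal_mul (by positivity)]
        congr 1
        field_simp
        norm_num
    _ ≤ ENNReal.ofReal (4 / r ^ 2) *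
          (ENNReal.ofReal (8 + 4 * B) * ∫⁻ q in disc r, ENNReal.ofReal (e q)) := by gcongr
    _ = _ := by
        rw [← mul_assoc, ← ENNReal.ofReal_mul (by positivity), div_mul_eq_mul_div]
end

section
/- Fix constants C > 0 and 0 < δ < π. Let α, ν : [0,∞) × [0,1] → ℂ be continuously differentiable functions satisfying ∂̄α = ν on the half-strip, where ∂̄α := ½(∂α/∂τ + i ∂α/∂t). Suppose (i) α(τ,0) ∈ ℝ and α(τ,1) ∈ ℝ for all τ ≥ 0; (ii) for every τ ≥ 0 the slice-wise bound (∫₀¹ |ν(τ,t)|² dt)^{1/2} + (∫₀¹ (|∂ν/∂τ(τ,t)|² + |∂ν/∂t(τ,t)|²) dt)^{1/2} ≤ C e^{−δτ} holds; and (iii) α(τ,t) converges, uniformly in t ∈ [0,1], to a real constant T as τ → +∞. Then there exists a constant C̄ > 0 such that (∫₀¹ |α(τ,t) − T|² dt)^{1/2} ≤ C̄ e^{−δτ} for all τ ≥ 0. -/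
open Set

lemma hasDerivAt_slice_fst {u : ℝ × ℝ → ℝ} (hu : ContDiff ℝ 1 u) (a t : ℝ) :
    HasDerivAt (fun s => u (s, t)) (fderiv ℝ u (a, t) (1, 0)) a :=
  ((hu.differentiable one_ne_zero (a, t)).hasFDerivAt).comp_hasDerivAt a
    ((hasDerivAt_id a).prodMk (hasDerivAt_const a t))

lemma hasDerivAt_slice_snd {u : ℝ × ℝ → ℝ} (hu : ContDiff ℝ 1 u) (a t : ℝ) :
    HasDerivAt (fun s => u (a, s)) (fderiv ℝ u (a, t) (0, 1)) t :=
  ((hu.differentiable one_ne_zero (a, t)).hasFDerivAt).comp_hasDerivAt t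
    ((hasDerivAt_const t a).prodMk (hasDerivAt_id t))

lemma continuous_fderiv_apply_const {u : ℝ × ℝ → ℝ} (hu : ContDiff ℝ 1 u) (w : ℝ × ℝ) :
    Continuous fun p => fderiv ℝ u p w :=
  (hu.continuous_fderiv one_ne_zero).clm_apply continuous_const

/-- Derivative at `a` of an integral of a continuous weight times an increment from `a`. -/
lemma hasDerivAt_integral_mul_sub {P u : ℝ × ℝ → ℝ} (hP : Continuous P) (hu : ContDiff ℝ 1 u)
    (a : ℝ) :
    HasDerivAt (fun b => ∫ t in (0:ℝ)..1, P (b, t) * (u (b, t) - u (a, t)))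
      (∫ t in (0:ℝ)..1, P (a, t) * fderiv ℝ u (a, t) (1, 0)) a := by
  have hc := continuous_fderiv_apply_const hu (1, 0)
  set D : ℝ × ℝ → ℝ := fun p => fderiv ℝ u p (1, 0) with hD
  have hinner : Continuous fun z : ℝ × ℝ => ∫ s in (0:ℝ)..1, D (a + s * (z.1 - a), z.2) :=
    intervalIntegral.continuous_parametric_intervalIntegral_of_continuous' (by fun_prop) 0 1
  have hJ : Continuous fun b : ℝ =>
      ∫ t in (0:ℝ)..1, P (b, t) * ∫ s in (0:ℝ)..1, D (a + s * (b - a), t) :=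
    intervalIntegral.continuous_parametric_intervalIntegral_of_continuous'
      (f := fun b t => P (b, t) * ∫ s in (0:ℝ)..1, D (a + s * (b - a), t))
      (by exact hP.mul hinner) 0 1
  have hincr (b t : ℝ) : u (b, t) - u (a, t)
      = (b - a) * ∫ s in (0:ℝ)..1, D (a + s * (b - a), t) := by
    have hd : ∀ s ∈ uIcc (0:ℝ) 1, HasDerivAt (fun s => u (a + s * (b - a), t))
        (D (a + s * (b - a), t) * (b - a)) s := fun s _ => by
      have h2 : HasDerivAt (fun s : ℝ => a + s * (b - a)) (b - a) s := by
        simpa using ((hasDerivAt_id s).mul_const (b - a)).const_add a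
      exact (hasDerivAt_slice_fst hu (a + s * (b - a)) t).comp s h2
    have := intervalIntegral.integral_eq_sub_of_hasDerivAt hd
      (Continuous.intervalIntegrable (by fun_prop) _ _)
    rw [intervalIntegral.integral_mul_const] at this
    simp at this
    rw [← this, mul_comm]
  have hfun (b : ℝ) : (∫ t in (0:ℝ)..1, P (b, t) * (u (b, t) - u (a, t)))
      = (b - a) * ∫ t in (0:ℝ)..1, P (b, t) * ∫ s in (0:ℝ)..1, D (a + s * (b - a), t) := by
    rw [← intervalIntegral.integral_const_mul]
    congr 1; ext t
    rw [hincr]; ring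
  rw [hasDerivAt_iff_tendsto_slope]
  have hlim := (hJ.tendsto a).mono_left (nhdsWithin_le_nhds (s := {a}ᶜ))
  simp only [sub_self, mul_zero, add_zero, intervalIntegral.integral_const, sub_zero, one_smul]
    at hlim
  refine hlim.congr' ?_
  filter_upwards [self_mem_nhdsWithin] with b hb
  have hb' : b - a ≠ 0 := sub_ne_zero.mpr hb
  rw [slope_def_field, hfun b, hfun a, sub_self, zero_mul, sub_zero, mul_div_cancel_left₀ _ hb']

/-- Wirtinger's inequality with Dirichlet boundary conditions, away from the sharp constant. -/
lemma wirtinger_dirichlet {v v' : ℝ → ℝ} (hv : ∀ t, HasDerivAt v (v' t) t) (hv' : Continuous v')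
    (h0 : v 0 = 0) (h1 : v 1 = 0) {κ : ℝ} (hκ0 : 0 < κ) (hκ : κ < Real.pi) :
    κ ^ 2 * ∫ t in (0:ℝ)..1, v t ^ 2 ≤ ∫ t in (0:ℝ)..1, v' t ^ 2 := by
  have hvc : Continuous v := continuous_iff_continuousAt.mpr fun t => (hv t).continuousAt
  have hcos : ∀ t ∈ Icc (0:ℝ) 1, 0 < Real.cos (κ * (t - 1 / 2)) := fun t ht =>
    Real.cos_pos_of_mem_Ioo ⟨by nlinarith [ht.1, ht.2], by nlinarith [ht.1, ht.2]⟩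
  have hd : ∀ t ∈ uIcc (0:ℝ) 1, HasDerivAt (fun t => κ * Real.tan (κ * (t - 1 / 2)) * v t ^ 2)
      (κ * (1 / Real.cos (κ * (t - 1 / 2)) ^ 2 * κ) * v t ^ 2
        + κ * Real.tan (κ * (t - 1 / 2)) * (2 * v t * v' t)) t := fun t ht => by
    rw [uIcc_of_le zero_le_one] at ht
    have hl : HasDerivAt (fun t : ℝ => κ * (t - 1 / 2)) κ t := by
      exact (((hasDerivAt_id t).sub_const (1 / 2)).const_mul κ).congr_deriv (mul_one κ)
    have htan := ((Real.hasDerivAt_tan (hcos t ht).ne').comp t hl).const_mul κ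
    have hsq := (hv t).pow 2
    simp only [Nat.cast_ofNat, Nat.add_one_sub_one, pow_one] at hsq
    exact htan.mul hsq
  have hcont : ContinuousOn (fun t => Real.tan (κ * (t - 1 / 2))) (uIcc (0:ℝ) 1) := by
    rw [uIcc_of_le zero_le_one]
    exact fun t ht => ((Real.continuousAt_tan.mpr (hcos t ht).ne').comp
      (f := fun t : ℝ => κ * (t - 1 / 2)) (by fun_prop)).continuousWithinAt
  have hcont' : ContinuousOn (fun t => 1 / Real.cos (κ * (t - 1 / 2)) ^ 2) (uIcc (0:ℝ) 1) := by
    rw [uIcc_of_le zero_le_one]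
    exact ContinuousOn.div (by fun_prop) (by fun_prop) fun t ht => pow_ne_zero 2 (hcos t ht).ne'
  have hint : IntervalIntegrable (fun t => κ * (1 / Real.cos (κ * (t - 1 / 2)) ^ 2 * κ) * v t ^ 2
        + κ * Real.tan (κ * (t - 1 / 2)) * (2 * v t * v' t)) MeasureTheory.volume 0 1 :=
    ContinuousOn.intervalIntegrable (by fun_prop)
  have hftc := intervalIntegral.integral_eq_sub_of_hasDerivAt hd hint
  rw [h0, h1] at hftc
  have hi1 : IntervalIntegrable (fun t => v' t ^ 2) MeasureTheory.volume 0 1 :=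
    Continuous.intervalIntegrable (by fun_prop) _ _
  have hi2 : IntervalIntegrable (fun t => κ ^ 2 * v t ^ 2) MeasureTheory.volume 0 1 :=
    Continuous.intervalIntegrable (by fun_prop) _ _
  have hmono := intervalIntegral.integral_mono_on zero_le_one hi2 (hi1.add hint) fun t ht => by
    have hc := hcos t ht
    have hsec : 1 / Real.cos (κ * (t - 1 / 2)) ^ 2 = 1 + Real.tan (κ * (t - 1 / 2)) ^ 2 := by
      rw [one_div, ← Real.inv_one_add_tan_sq hc.ne', inv_inv]
    rw [hsec]
    nlinarith [sq_nonneg (v' t + κ * Real.tan (κ * (t - 1 / 2)) * v t)]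
  rw [intervalIntegral.integral_const_mul] at hmono
  rw [intervalIntegral.integral_add hi1 hint, hftc] at hmono
  linarith

/-- Wirtinger's inequality for functions of mean zero, away from the sharp constant. -/
lemma wirtinger_of_integral_eq_zero {u u' : ℝ → ℝ} (hu : ∀ t, HasDerivAt u (u' t) t)
    (hu' : Continuous u') (hmean : ∫ t in (0:ℝ)..1, u t = 0) {κ : ℝ} (hκ0 : 0 < κ)
    (hκ : κ < Real.pi) :
    κ ^ 2 * ∫ t in (0:ℝ)..1, u t ^ 2 ≤ ∫ t in (0:ℝ)..1, u' t ^ 2 := by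
  have huc : Continuous u := continuous_iff_continuousAt.mpr fun t => (hu t).continuousAt
  set U : ℝ → ℝ := fun t => ∫ s in (0:ℝ)..t, u s with hU
  have hUd (t : ℝ) : HasDerivAt U (u t) t := huc.integral_hasStrictDerivAt 0 t |>.hasDerivAt
  have hUc : Continuous U := continuous_iff_continuousAt.mpr fun t => (hUd t).continuousAt
  have hU0 : U 0 = 0 := by simp [hU]
  have hdir := wirtinger_dirichlet hUd huc hU0 hmean hκ0 hκ
  have hi {f : ℝ → ℝ} (hf : Continuous f) : IntervalIntegrable f MeasureTheory.volume 0 1 :=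
    hf.intervalIntegrable _ _
  have hparts : (∫ t in (0:ℝ)..1, (u t ^ 2 + U t * u' t)) = 0 := by
    rw [intervalIntegral.integral_eq_sub_of_hasDerivAt (f := fun t => U t * u t)
      (fun t _ => ((hUd t).mul (hu t)).congr_deriv (by ring)) (hi (by fun_prop))]
    rw [show U 1 = 0 from hmean, hU0]; ring
  have hmono : (∫ t in (0:ℝ)..1, 2 * κ ^ 2 * u t ^ 2) ≤ ∫ t in (0:ℝ)..1,
      (κ ^ 2 * (κ ^ 2 * U t ^ 2) + u' t ^ 2 + 2 * κ ^ 2 * (u t ^ 2 + U t * u' t)) :=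
    intervalIntegral.integral_mono_on zero_le_one (hi (by fun_prop)) (hi (by fun_prop))
      fun t _ => by nlinarith [sq_nonneg (κ ^ 2 * U t + u' t)]
  rw [intervalIntegral.integral_add (hi (by fun_prop)) (hi (by fun_prop)),
    intervalIntegral.integral_add (hi (by fun_prop)) (hi (by fun_prop))] at hmono
  simp only [intervalIntegral.integral_const_mul] at hmono
  rw [hparts] at hmono
  nlinarith [mul_le_mul_of_nonneg_left hdir (sq_nonneg κ)]

lemma abs_integral_mul_add_mul_le {x y p q : ℝ → ℝ} (hx : Continuous x) (hy : Continuous y)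
    (hp : Continuous p) (hq : Continuous q) {c : ℝ} (hc : 0 < c) :
    |4 * ∫ t in (0:ℝ)..1, (x t * p t + y t * q t)|
      ≤ c * (∫ t in (0:ℝ)..1, (x t ^ 2 + y t ^ 2)) + 4 / c * ∫ t in (0:ℝ)..1, (p t ^ 2 + q t ^ 2) := by
  have hi {f : ℝ → ℝ} (hf : Continuous f) : IntervalIntegrable f MeasureTheory.volume 0 1 :=
    hf.intervalIntegrable _ _
  have key (a b : ℝ) : |4 * (a * b)| ≤ c * a ^ 2 + 4 / c * b ^ 2 := by
    have h : c * a ^ 2 + 4 / c * b ^ 2 = ((c * a) ^ 2 + (2 * b) ^ 2) / c := by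
      field_simp; ring
    rw [h, le_div_iff₀ hc, ← abs_of_pos hc, ← abs_mul, abs_of_pos hc, abs_le]
    constructor <;> nlinarith [sq_nonneg (c * a + 2 * b), sq_nonneg (c * a - 2 * b)]
  rw [← intervalIntegral.integral_const_mul, ← intervalIntegral.integral_const_mul,
    ← intervalIntegral.integral_const_mul,
    ← intervalIntegral.integral_add (hi (by fun_prop)) (hi (by fun_prop))]
  refine (intervalIntegral.abs_integral_le_integral_abs zero_le_one).trans
    (intervalIntegral.integral_mono_on zero_le_one (hi (by fun_prop)) (hi (by fun_prop)) ?_)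
  intro t _
  have h1 := key (x t) (p t)
  have h2 := key (y t) (q t)
  rw [mul_add]
  refine (abs_add_le _ _).trans ?_
  linarith

/-- Exponential decay of a bounded nonnegative function `f` governed by a hyperbolic system of
differential inequalities. -/
lemma exp_decay_of_differential_inequalities {f h f' h' : ℝ → ℝ} {κ δ ε K B τ₁ : ℝ}
    (hδ : 0 < δ) (hε : 0 < ε) (hκ : 2 * δ < 2 * κ - ε) (hK : 0 ≤ K)
    (hfc : ContinuousOn f (Ici 0)) (hhc : ContinuousOn h (Ici 0))
    (hf : ∀ τ > 0, HasDerivAt f (f' τ) τ) (hh : ∀ τ > 0, HasDerivAt h (h' τ) τ)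
    (hf0 : ∀ τ ≥ 0, 0 ≤ f τ) (hfB : ∀ τ ≥ τ₁, f τ ≤ B)
    (hf' : ∀ τ > 0, |f' τ - (2 * h τ - 2 * κ * f τ)| ≤ ε * f τ + K * Real.exp (-(2 * δ) * τ))
    (hh' : ∀ τ > 0, 2 * κ * h τ - K * Real.exp (-(2 * δ) * τ) ≤ h' τ) :
    ∃ M > 0, ∀ τ ≥ 0, f τ ≤ M * Real.exp (-(2 * δ) * τ) := by
  have hκ0 : 0 < κ := by linarith
  have hexp (c τ : ℝ) : HasDerivAt (fun τ => Real.exp (c * τ)) (Real.exp (c * τ) * c) τ := by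
    have : HasDerivAt (fun τ : ℝ => c * τ) c τ := by simpa using (hasDerivAt_id τ).const_mul c
    exact this.exp
  set K' := K / (2 * κ + 2 * δ) with hK'
  have hK'0 : 0 ≤ K' := by positivity
  have hK'e : K' * (2 * κ + 2 * δ) = K := by rw [hK']; field_simp
  have hk : MonotoneOn
      (fun τ => Real.exp (-(2 * κ) * τ) * (h τ - K' * Real.exp (-(2 * δ) * τ))) (Ici 0) := by
    refine monotoneOn_of_hasDerivWithinAt_nonneg (convex_Ici 0) (by fun_prop)
      (fun τ hτ => ((hexp (-(2 * κ)) τ).mul ((hh τ (by simpa using hτ)).sub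
        ((hexp (-(2 * δ)) τ).const_mul K'))).hasDerivWithinAt) fun τ hτ => ?_
    have h1 := hh' τ (by simpa using hτ)
    have h2 : Real.exp (-(2 * κ) * τ) * -(2 * κ) * (h τ - K' * Real.exp (-(2 * δ) * τ))
        + Real.exp (-(2 * κ) * τ) * (h' τ - K' * (Real.exp (-(2 * δ) * τ) * -(2 * δ)))
        = Real.exp (-(2 * κ) * τ) * (h' τ - (2 * κ * h τ
          - K' * (2 * κ + 2 * δ) * Real.exp (-(2 * δ) * τ))) := by ring
    simp only [Pi.sub_apply]
    rw [h2, hK'e]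
    exact mul_nonneg (Real.exp_pos _).le (by linarith)
  have hle : ∀ τ ≥ 0, h τ ≤ K' * Real.exp (-(2 * δ) * τ) := by
    intro τ₀ hτ₀
    by_contra! hlt
    set c := Real.exp (-(2 * κ) * τ₀) * (h τ₀ - K' * Real.exp (-(2 * δ) * τ₀)) with hc
    have hc0 : 0 < c := mul_pos (Real.exp_pos _) (by linarith)
    have hgrow : ∀ τ ≥ τ₀, c * Real.exp (2 * κ * τ) ≤ h τ := fun τ hτ => by
      have h1 : c ≤ _ := hk (mem_Ici.mpr hτ₀) (mem_Ici.mpr (hτ₀.trans hτ)) hτ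
      have h2 := mul_le_mul_of_nonneg_right h1 (Real.exp_pos (2 * κ * τ)).le
      have h3 : Real.exp (-(2 * κ) * τ) * Real.exp (2 * κ * τ) = 1 := by
        rw [← Real.exp_add]; simp
      have h4 : Real.exp (-(2 * κ) * τ) * (h τ - K' * Real.exp (-(2 * δ) * τ))
          * Real.exp (2 * κ * τ) = h τ - K' * Real.exp (-(2 * δ) * τ) := by
        linear_combination (h τ - K' * Real.exp (-(2 * δ) * τ)) * h3
      have h5 : 0 ≤ K' * Real.exp (-(2 * δ) * τ) := by positivity
      linarith
    have htend : Filter.Tendsto (fun τ => c * Real.exp (2 * κ * τ)) Filter.atTop Filter.atTop :=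
      (Real.tendsto_exp_atTop.comp
        (Filter.tendsto_id.const_mul_atTop (by positivity))).const_mul_atTop hc0
    obtain ⟨τ₂, hτ₂⟩ := Filter.eventually_atTop.mp
      (htend.eventually_ge_atTop (1 + (2 * κ + ε) * |B| + K))
    set σ := max (max τ₀ τ₁) (max τ₂ 1) with hσ
    have hσ0 : τ₀ ≤ σ := (le_max_left _ _).trans (le_max_left _ _)
    have hσ1 : τ₁ ≤ σ := (le_max_right _ _).trans (le_max_left _ _)
    have hσ2 : τ₂ ≤ σ := (le_max_left _ _).trans (le_max_right _ _)
    have hσ3 : 1 ≤ σ := (le_max_right _ _).trans (le_max_right _ _)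
    have hmono : MonotoneOn (fun τ => f τ - τ) (Ici σ) := by
      refine monotoneOn_of_hasDerivWithinAt_nonneg (f' := fun τ => f' τ - 1) (convex_Ici σ)
        ((hfc.mono (Ici_subset_Ici.mpr (by linarith))).sub continuousOn_id)
        (fun τ hτ => ?_) fun τ hτ => ?_
      · have : σ < τ := by simpa using hτ
        exact ((hf τ (by linarith)).sub (hasDerivAt_id τ)).hasDerivWithinAt
      · have hστ : σ < τ := by simpa using hτ
        have h1 := (abs_le.mp (hf' τ (by linarith))).1
        have h2 := hgrow τ (by linarith)
        have h3 := hτ₂ τ (by linarith)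
        have h4 : f τ ≤ |B| := (hfB τ (by linarith)).trans (le_abs_self B)
        have h5 : Real.exp (-(2 * δ) * τ) ≤ 1 := Real.exp_le_one_iff.mpr (by nlinarith)
        have h6 := mul_le_mul_of_nonneg_left h5 hK
        have h7 := mul_le_mul_of_nonneg_left h4 (by linarith : 0 ≤ 2 * κ + ε)
        have h8 : 0 ≤ (2 * κ + ε) * |B| := by positivity
        linarith
    have h1 := hmono (mem_Ici.mpr le_rfl) (mem_Ici.mpr (by linarith [abs_nonneg B] : σ ≤ σ + |B| + 1))
      (by linarith [abs_nonneg B])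
    have h2 := hf0 σ (by linarith)
    have h3 := hfB (σ + |B| + 1) (by linarith [abs_nonneg B])
    simp only at h1
    linarith [le_abs_self B]
  set a := 2 * κ - ε with ha
  have haδ : 0 < a - 2 * δ := by linarith
  set M := (2 * K' + K) / (a - 2 * δ) with hM
  have hM0 : 0 ≤ M := by positivity
  have hMe : M * (a - 2 * δ) = 2 * K' + K := by rw [hM]; field_simp
  have hanti : AntitoneOn
      (fun τ => Real.exp (a * τ) * (f τ - M * Real.exp (-(2 * δ) * τ))) (Ici 0) := by
    refine antitoneOn_of_hasDerivWithinAt_nonpos (convex_Ici 0) (by fun_prop)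
      (fun τ hτ => ((hexp a τ).mul ((hf τ (by simpa using hτ)).sub
        ((hexp (-(2 * δ)) τ).const_mul M))).hasDerivWithinAt) fun τ hτ => ?_
    have hτ0 : 0 < τ := by simpa using hτ
    have h1 := (abs_le.mp (hf' τ hτ0)).2
    have h3 := hle τ hτ0.le
    have h2 : Real.exp (a * τ) * a * (f τ - M * Real.exp (-(2 * δ) * τ))
        + Real.exp (a * τ) * (f' τ - M * (Real.exp (-(2 * δ) * τ) * -(2 * δ)))
        = Real.exp (a * τ) * (f' τ + a * f τ
          - M * (a - 2 * δ) * Real.exp (-(2 * δ) * τ)) := by ring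
    simp only [Pi.sub_apply]
    rw [h2, hMe]
    refine mul_nonpos_of_nonneg_of_nonpos (Real.exp_pos _).le ?_
    rw [ha]; linarith
  refine ⟨M + f 0 + 1, by linarith [hf0 0 le_rfl], fun τ hτ => ?_⟩
  have h1 := hanti (mem_Ici.mpr le_rfl) (mem_Ici.mpr hτ) hτ
  simp only [mul_zero, Real.exp_zero, one_mul, mul_one] at h1
  have h2 : f τ - M * Real.exp (-(2 * δ) * τ) ≤ f 0 * Real.exp (-a * τ) := by
    have h3 : Real.exp (-a * τ) * Real.exp (a * τ) = 1 := by rw [← Real.exp_add]; simp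
    have h4 := mul_le_mul_of_nonneg_left h1 (Real.exp_pos (-a * τ)).le
    rw [← mul_assoc, h3] at h4
    nlinarith [mul_nonneg (Real.exp_pos (-a * τ)).le hM0]
  have h5 : Real.exp (-a * τ) ≤ Real.exp (-(2 * δ) * τ) := Real.exp_le_exp.mpr (by nlinarith)
  have h6 := mul_le_mul_of_nonneg_left h5 (hf0 0 le_rfl)
  nlinarith [Real.exp_pos (-(2 * δ) * τ)]

section HalfStrip

variable {u v p q : ℝ × ℝ → ℝ}

/-- Let `u + iv` solve `∂̄(u + iv) = p + iq` on a slice with real boundary values; this is the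
derivative of the mean of `u`. -/
lemma hasDerivAt_integral_re (hu : ContDiff ℝ 1 u) (hv : ContDiff ℝ 1 v) (hp : Continuous p)
    {a : ℝ}
    (he : ∀ t ∈ Icc (0:ℝ) 1,
      fderiv ℝ u (a, t) (1, 0) = fderiv ℝ v (a, t) (0, 1) + 2 * p (a, t))
    (h0 : v (a, 0) = 0) (h1 : v (a, 1) = 0) :
    HasDerivAt (fun b => ∫ t in (0:ℝ)..1, u (b, t)) (2 * ∫ t in (0:ℝ)..1, p (a, t)) a := by
  have huc := hu.continuous
  have hvt := continuous_fderiv_apply_const hv (0, 1)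
  have hi {f : ℝ → ℝ} (hf : Continuous f) : IntervalIntegrable f MeasureTheory.volume 0 1 :=
    hf.intervalIntegrable _ _
  have hvt' : Continuous fun t => fderiv ℝ v (a, t) (0, 1) := hvt.comp (by fun_prop)
  have hd := (hasDerivAt_integral_mul_sub (P := fun _ => 1) continuous_const hu a).const_add
    (∫ t in (0:ℝ)..1, u (a, t))
  refine (hd.congr_deriv ?_).congr_of_eventuallyEq (Filter.Eventually.of_forall fun b => ?_)
  · rw [intervalIntegral.integral_congr
      (g := fun t => fderiv ℝ v (a, t) (0, 1) + 2 * p (a, t)) (fun t ht => by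
        rw [uIcc_of_le zero_le_one] at ht
        simp [he t ht]),
      intervalIntegral.integral_add (hi hvt') (hi (by fun_prop)),
      intervalIntegral.integral_const_mul,
      intervalIntegral.integral_eq_sub_of_hasDerivAt
        (fun t _ => hasDerivAt_slice_snd hv a t) (hi hvt'), h0, h1]
    ring
  · simp only [one_mul]
    rw [intervalIntegral.integral_sub (hi (by fun_prop)) (hi (by fun_prop))]
    ring

/-- Derivative of the squared `L²` norm of a slice of a solution of `∂̄(u + iv) = p + iq`. -/
lemma hasDerivAt_integral_sq_add_sq (hu : ContDiff ℝ 1 u) (hv : ContDiff ℝ 1 v)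
    (hp : Continuous p) (hq : Continuous q) {a : ℝ}
    (he₁ : ∀ t ∈ Icc (0:ℝ) 1,
      fderiv ℝ u (a, t) (1, 0) = fderiv ℝ v (a, t) (0, 1) + 2 * p (a, t))
    (he₂ : ∀ t ∈ Icc (0:ℝ) 1,
      fderiv ℝ v (a, t) (1, 0) = -fderiv ℝ u (a, t) (0, 1) + 2 * q (a, t)) :
    HasDerivAt (fun b => ∫ t in (0:ℝ)..1, (u (b, t) ^ 2 + v (b, t) ^ 2))
      (-2 * (∫ t in (0:ℝ)..1,
          (fderiv ℝ u (a, t) (0, 1) * v (a, t) - fderiv ℝ v (a, t) (0, 1) * u (a, t)))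
        + 4 * ∫ t in (0:ℝ)..1, (u (a, t) * p (a, t) + v (a, t) * q (a, t))) a := by
  have huc := hu.continuous
  have hvc := hv.continuous
  have hi {f : ℝ → ℝ} (hf : Continuous f) : IntervalIntegrable f MeasureTheory.volume 0 1 :=
    hf.intervalIntegrable _ _
  have hut : Continuous fun t => fderiv ℝ u (a, t) (0, 1) :=
    (continuous_fderiv_apply_const hu (0, 1)).comp (by fun_prop)
  have hvt : Continuous fun t => fderiv ℝ v (a, t) (0, 1) :=
    (continuous_fderiv_apply_const hv (0, 1)).comp (by fun_prop)
  have huτ : Continuous fun t => fderiv ℝ u (a, t) (1, 0) :=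
    (continuous_fderiv_apply_const hu (1, 0)).comp (by fun_prop)
  have hvτ : Continuous fun t => fderiv ℝ v (a, t) (1, 0) :=
    (continuous_fderiv_apply_const hv (1, 0)).comp (by fun_prop)
  have hd := ((hasDerivAt_integral_mul_sub (P := fun z => u z + u (a, z.2))
    (by fun_prop) hu a).add (hasDerivAt_integral_mul_sub (P := fun z => v z + v (a, z.2))
    (by fun_prop) hv a)).const_add (∫ t in (0:ℝ)..1, (u (a, t) ^ 2 + v (a, t) ^ 2))
  refine (hd.congr_deriv ?_).congr_of_eventuallyEq (Filter.Eventually.of_forall fun b => ?_)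
  · rw [← intervalIntegral.integral_const_mul, ← intervalIntegral.integral_const_mul,
      ← intervalIntegral.integral_add (hi (by fun_prop)) (hi (by fun_prop)),
      ← intervalIntegral.integral_add (hi (by fun_prop)) (hi (by fun_prop))]
    refine intervalIntegral.integral_congr fun t ht => ?_
    rw [uIcc_of_le zero_le_one] at ht
    simp only [he₁ t ht, he₂ t ht]
    ring
  · simp only [Pi.add_apply]
    rw [← intervalIntegral.integral_add (hi (by fun_prop)) (hi (by fun_prop)),
      ← intervalIntegral.integral_add (hi (by fun_prop)) (hi (by fun_prop))]
    congr 1; ext t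
    ring

/-- Derivative of the quadratic form of the asymptotic operator `i∂ₜ` along a solution of
`∂̄(u + iv) = p + iq` with real boundary values. -/
lemma hasDerivAt_integral_asymptotic_form (hu : ContDiff ℝ 1 u) (hv : ContDiff ℝ 1 v)
    (hp : Continuous p) (hq : Continuous q) {a : ℝ} (ha : 0 < a)
    (he₁ : ∀ t ∈ Icc (0:ℝ) 1,
      fderiv ℝ u (a, t) (1, 0) = fderiv ℝ v (a, t) (0, 1) + 2 * p (a, t))
    (he₂ : ∀ t ∈ Icc (0:ℝ) 1,
      fderiv ℝ v (a, t) (1, 0) = -fderiv ℝ u (a, t) (0, 1) + 2 * q (a, t))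
    (hbc : ∀ τ ≥ 0, v (τ, 0) = 0 ∧ v (τ, 1) = 0) :
    HasDerivAt (fun b => ∫ t in (0:ℝ)..1,
        (fderiv ℝ u (b, t) (0, 1) * v (b, t) - fderiv ℝ v (b, t) (0, 1) * u (b, t)))
      (-2 * (∫ t in (0:ℝ)..1, (fderiv ℝ u (a, t) (0, 1) ^ 2 + fderiv ℝ v (a, t) (0, 1) ^ 2))
        + 4 * ∫ t in (0:ℝ)..1, (fderiv ℝ u (a, t) (0, 1) * q (a, t)
          + -fderiv ℝ v (a, t) (0, 1) * p (a, t))) a := by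
  have huc := hu.continuous
  have hvc := hv.continuous
  have hi {f : ℝ → ℝ} (hf : Continuous f) : IntervalIntegrable f MeasureTheory.volume 0 1 :=
    hf.intervalIntegrable _ _
  have hutc := continuous_fderiv_apply_const hu (0, 1)
  have hvtc := continuous_fderiv_apply_const hv (0, 1)
  have hut (b : ℝ) : Continuous fun t => fderiv ℝ u (b, t) (0, 1) := hutc.comp (by fun_prop)
  have hvt (b : ℝ) : Continuous fun t => fderiv ℝ v (b, t) (0, 1) := hvtc.comp (by fun_prop)
  have hut' : Continuous fun z : ℝ × ℝ => fderiv ℝ u (a, z.2) (0, 1) :=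
    hutc.comp (g := fun z => fderiv ℝ u z (0, 1)) (f := fun z : ℝ × ℝ => (a, z.2)) (by fun_prop)
  have hvt' : Continuous fun z : ℝ × ℝ => fderiv ℝ v (a, z.2) (0, 1) :=
    hvtc.comp (g := fun z => fderiv ℝ v z (0, 1)) (f := fun z : ℝ × ℝ => (a, z.2)) (by fun_prop)
  have huτ : Continuous fun t => fderiv ℝ u (a, t) (1, 0) :=
    (continuous_fderiv_apply_const hu (1, 0)).comp (by fun_prop)
  have hvτ : Continuous fun t => fderiv ℝ v (a, t) (1, 0) :=
    (continuous_fderiv_apply_const hv (1, 0)).comp (by fun_prop)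
  have hd := ((hasDerivAt_integral_mul_sub
    (P := fun z => fderiv ℝ u z (0, 1) + fderiv ℝ u (a, z.2) (0, 1))
    (hutc.add hut') hv a).add (hasDerivAt_integral_mul_sub
    (P := fun z => -(fderiv ℝ v z (0, 1) + fderiv ℝ v (a, z.2) (0, 1)))
    (hvtc.add hvt').neg hu a)).const_add (∫ t in (0:ℝ)..1,
        (fderiv ℝ u (a, t) (0, 1) * v (a, t) - fderiv ℝ v (a, t) (0, 1) * u (a, t)))
  have hua := hut a
  have hva := hvt a
  refine (hd.congr_deriv ?_).congr_of_eventuallyEq ?_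
  · rw [← intervalIntegral.integral_const_mul, ← intervalIntegral.integral_const_mul,
      ← intervalIntegral.integral_add (hi (by fun_prop)) (hi (by fun_prop)),
      ← intervalIntegral.integral_add (hi (by fun_prop)) (hi (by fun_prop))]
    refine intervalIntegral.integral_congr fun t ht => ?_
    rw [uIcc_of_le zero_le_one] at ht
    simp only [he₁ t ht, he₂ t ht]
    ring
  · filter_upwards [lt_mem_nhds ha] with b hb
    have hub := hut b
    have hvb := hvt b
    have hsymm := intervalIntegral.integral_eq_sub_of_hasDerivAt
      (fun t (_ : t ∈ uIcc (0:ℝ) 1) =>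
        ((hasDerivAt_slice_snd hv b t).mul (hasDerivAt_slice_snd hu a t)).sub
          ((hasDerivAt_slice_snd hu b t).mul (hasDerivAt_slice_snd hv a t)))
      (hi (by fun_prop))
    simp only [Pi.sub_apply, Pi.mul_apply, (hbc a ha.le).1, (hbc a ha.le).2, (hbc b hb.le).1,
      (hbc b hb.le).2, zero_mul, mul_zero, sub_zero] at hsymm
    refine (sub_eq_zero.mp (Eq.trans ?_ hsymm)).symm
    simp only [Pi.add_apply]
    rw [← intervalIntegral.integral_add (hi (by fun_prop)) (hi (by fun_prop)),
      ← intervalIntegral.integral_add (hi (by fun_prop)) (hi (by fun_prop)),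
      ← intervalIntegral.integral_sub (hi (by fun_prop)) (hi (by fun_prop))]
    congr 1; ext t
    ring

/-- A function whose derivative decays exponentially approaches its limit exponentially. -/
lemma abs_sub_le_of_abs_deriv_le_exp {m m' : ℝ → ℝ} {T A δ : ℝ} (hδ : 0 < δ)
    (hm : ContinuousOn m (Ici 0)) (hm' : ∀ τ > 0, HasDerivAt m (m' τ) τ)
    (hle : ∀ τ > 0, |m' τ| ≤ A * Real.exp (-δ * τ))
    (hlim : Filter.Tendsto m Filter.atTop (nhds T)) {τ : ℝ} (hτ : 0 ≤ τ) :
    |m τ - T| ≤ A / δ * Real.exp (-δ * τ) := by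
  have hexp (τ : ℝ) : HasDerivAt (fun τ => A / δ * Real.exp (-δ * τ))
      (-(A * Real.exp (-δ * τ))) τ := by
    have : HasDerivAt (fun τ : ℝ => -δ * τ) (-δ) τ := by
      simpa using (hasDerivAt_id τ).const_mul (-δ)
    refine (this.exp.const_mul (A / δ)).congr_deriv ?_
    field_simp
  have hexplim : Filter.Tendsto (fun τ => A / δ * Real.exp (-δ * τ)) Filter.atTop (nhds 0) := by
    have : Filter.Tendsto (fun τ : ℝ => -δ * τ) Filter.atTop Filter.atBot :=
      Filter.tendsto_id.const_mul_atTop_of_neg (by linarith)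
    simpa using (Real.tendsto_exp_atBot.comp this).const_mul (A / δ)
  have hc : ContinuousOn (fun τ => A / δ * Real.exp (-δ * τ)) (Ici 0) := by fun_prop
  have hup : MonotoneOn (fun τ => m τ - A / δ * Real.exp (-δ * τ)) (Ici 0) :=
    monotoneOn_of_hasDerivWithinAt_nonneg (convex_Ici 0) (hm.sub hc)
      (fun τ hτ => ((hm' τ (by simpa using hτ)).sub (hexp τ)).hasDerivWithinAt)
      fun τ hτ => by linarith [(abs_le.mp (hle τ (by simpa using hτ))).1]
  have hdown : AntitoneOn (fun τ => m τ + A / δ * Real.exp (-δ * τ)) (Ici 0) :=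
    antitoneOn_of_hasDerivWithinAt_nonpos (convex_Ici 0) (hm.add hc)
      (fun τ hτ => ((hm' τ (by simpa using hτ)).add (hexp τ)).hasDerivWithinAt)
      fun τ hτ => by linarith [(abs_le.mp (hle τ (by simpa using hτ))).2]
  have h1 : m τ - A / δ * Real.exp (-δ * τ) ≤ T := by
    have hl := hlim.sub hexplim
    rw [sub_zero] at hl
    refine ge_of_tendsto hl ?_
    filter_upwards [Filter.eventually_ge_atTop τ] with s hs
    exact hup (mem_Ici.mpr hτ) (mem_Ici.mpr (hτ.trans hs)) hs
  have h2 : T ≤ m τ + A / δ * Real.exp (-δ * τ) := by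
    have hl := hlim.add hexplim
    rw [add_zero] at hl
    refine le_of_tendsto hl ?_
    filter_upwards [Filter.eventually_ge_atTop τ] with s hs
    exact hdown (mem_Ici.mpr hτ) (mem_Ici.mpr (hτ.trans hs)) hs
  rw [abs_le]
  constructor <;> linarith

/-- Squared `L²` distance of a slice from a real constant, split off the mean of `u`. -/
lemma integral_sub_sq_add_sq {x y : ℝ → ℝ} (hx : Continuous x) (hy : Continuous y) (c : ℝ) :
    (∫ t in (0:ℝ)..1, ((x t - c) ^ 2 + y t ^ 2))
      = (∫ t in (0:ℝ)..1, (x t ^ 2 + y t ^ 2)) - 2 * c * (∫ t in (0:ℝ)..1, x t) + c ^ 2 := by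
  have hi {f : ℝ → ℝ} (hf : Continuous f) : IntervalIntegrable f MeasureTheory.volume 0 1 :=
    hf.intervalIntegrable _ _
  have h : (∫ t in (0:ℝ)..1, ((x t - c) ^ 2 + y t ^ 2))
      = ∫ t in (0:ℝ)..1, ((x t ^ 2 + y t ^ 2) - 2 * c * x t + c ^ 2) := by
    congr 1; ext t; ring
  rw [h, intervalIntegral.integral_add (hi (by fun_prop)) (hi (by fun_prop)),
    intervalIntegral.integral_sub (hi (by fun_prop)) (hi (by fun_prop)),
    intervalIntegral.integral_const_mul]
  simp

lemma sq_integral_le_integral_sq_add_sq {x y : ℝ → ℝ} (hx : Continuous x) (hy : Continuous y) :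
    (∫ t in (0:ℝ)..1, x t) ^ 2 ≤ ∫ t in (0:ℝ)..1, (x t ^ 2 + y t ^ 2) := by
  have h := integral_sub_sq_add_sq hx hy (∫ t in (0:ℝ)..1, x t)
  have h0 : 0 ≤ ∫ t in (0:ℝ)..1, ((x t - ∫ t in (0:ℝ)..1, x t) ^ 2 + y t ^ 2) :=
    intervalIntegral.integral_nonneg zero_le_one fun t _ => by positivity
  nlinarith

/-- Real form of the exponential decay of solutions of `∂̄(u + iv) = p + iq` on the half-strip
with real boundary values. -/
lemma exp_decay_of_cauchyRiemann {A δ T : ℝ} (hA : 0 ≤ A) (hδ0 : 0 < δ) (hδπ : δ < Real.pi)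
    (hu : ContDiff ℝ 1 u) (hv : ContDiff ℝ 1 v) (hp : Continuous p) (hq : Continuous q)
    (he₁ : ∀ τ ≥ 0, ∀ t ∈ Icc (0:ℝ) 1,
      fderiv ℝ u (τ, t) (1, 0) = fderiv ℝ v (τ, t) (0, 1) + 2 * p (τ, t))
    (he₂ : ∀ τ ≥ 0, ∀ t ∈ Icc (0:ℝ) 1,
      fderiv ℝ v (τ, t) (1, 0) = -fderiv ℝ u (τ, t) (0, 1) + 2 * q (τ, t))
    (hbc : ∀ τ ≥ 0, v (τ, 0) = 0 ∧ v (τ, 1) = 0)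
    (hn : ∀ τ ≥ 0, (∫ t in (0:ℝ)..1, (p (τ, t) ^ 2 + q (τ, t) ^ 2))
      ≤ A ^ 2 * Real.exp (-(2 * δ) * τ))
    (hconv : Filter.Tendsto (fun τ => ∫ t in (0:ℝ)..1, ((u (τ, t) - T) ^ 2 + v (τ, t) ^ 2))
      Filter.atTop (nhds 0)) :
    ∃ M > 0, ∀ τ ≥ 0, (∫ t in (0:ℝ)..1, ((u (τ, t) - T) ^ 2 + v (τ, t) ^ 2))
      ≤ M * Real.exp (-(2 * δ) * τ) := by
  have huc := hu.continuous
  have hvc := hv.continuous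
  have hutc := continuous_fderiv_apply_const hu (0, 1)
  have hvtc := continuous_fderiv_apply_const hv (0, 1)
  have hus (τ : ℝ) : Continuous fun t => u (τ, t) := by fun_prop
  have hvs (τ : ℝ) : Continuous fun t => v (τ, t) := by fun_prop
  have hps (τ : ℝ) : Continuous fun t => p (τ, t) := by fun_prop
  have hqs (τ : ℝ) : Continuous fun t => q (τ, t) := by fun_prop
  have hut (τ : ℝ) : Continuous fun t => fderiv ℝ u (τ, t) (0, 1) := hutc.comp (by fun_prop)
  have hvt (τ : ℝ) : Continuous fun t => fderiv ℝ v (τ, t) (0, 1) := hvtc.comp (by fun_prop)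
  have hi {f : ℝ → ℝ} (hf : Continuous f) : IntervalIntegrable f MeasureTheory.volume 0 1 :=
    hf.intervalIntegrable _ _
  set m : ℝ → ℝ := fun τ => ∫ t in (0:ℝ)..1, u (τ, t) with hm
  set F : ℝ → ℝ := fun τ => ∫ t in (0:ℝ)..1, (u (τ, t) ^ 2 + v (τ, t) ^ 2) with hF
  set g : ℝ → ℝ := fun τ => ∫ t in (0:ℝ)..1,
    (fderiv ℝ u (τ, t) (0, 1) * v (τ, t) - fderiv ℝ v (τ, t) (0, 1) * u (τ, t)) with hg
  set N : ℝ → ℝ := fun τ => ∫ t in (0:ℝ)..1,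
    (fderiv ℝ u (τ, t) (0, 1) ^ 2 + fderiv ℝ v (τ, t) (0, 1) ^ 2) with hN
  set f : ℝ → ℝ := fun τ => F τ - m τ ^ 2 with hf
  set X : ℝ → ℝ := fun τ => ∫ t in (0:ℝ)..1,
    ((u (τ, t) - m τ) * p (τ, t) + v (τ, t) * q (τ, t)) with hX
  set Y : ℝ → ℝ := fun τ => ∫ t in (0:ℝ)..1,
    (fderiv ℝ u (τ, t) (0, 1) * q (τ, t) + -fderiv ℝ v (τ, t) (0, 1) * p (τ, t)) with hY
  have hmc : Continuous m :=
    intervalIntegral.continuous_parametric_intervalIntegral_of_continuous'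
      (f := fun τ t => u (τ, t)) huc 0 1
  have hFc : Continuous F :=
    intervalIntegral.continuous_parametric_intervalIntegral_of_continuous'
      (f := fun τ t => u (τ, t) ^ 2 + v (τ, t) ^ 2) (by exact (huc.pow 2).add (hvc.pow 2)) 0 1
  have hgc : Continuous g :=
    intervalIntegral.continuous_parametric_intervalIntegral_of_continuous'
      (f := fun τ t => fderiv ℝ u (τ, t) (0, 1) * v (τ, t) - fderiv ℝ v (τ, t) (0, 1) * u (τ, t))
      ((hutc.mul hvc).sub (hvtc.mul huc)) 0 1
  have hdist (τ c : ℝ) : (∫ t in (0:ℝ)..1, ((u (τ, t) - c) ^ 2 + v (τ, t) ^ 2))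
      = f τ + (m τ - c) ^ 2 := by
    rw [integral_sub_sq_add_sq (hus τ) (hvs τ)]
    simp only [hf, hF, hm]
    ring
  have hfm (τ : ℝ) : f τ = ∫ t in (0:ℝ)..1, ((u (τ, t) - m τ) ^ 2 + v (τ, t) ^ 2) := by
    rw [hdist]; ring
  have hf0 (τ : ℝ) : 0 ≤ f τ := by
    rw [hfm]
    exact intervalIntegral.integral_nonneg zero_le_one fun t _ => by positivity
  have hmd : ∀ τ > 0, HasDerivAt m (2 * ∫ t in (0:ℝ)..1, p (τ, t)) τ := fun τ hτ =>
    hasDerivAt_integral_re hu hv hp (he₁ τ hτ.le) (hbc τ hτ.le).1 (hbc τ hτ.le).2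
  have hfd : ∀ τ > 0, HasDerivAt f (-2 * g τ + 4 * X τ) τ := fun τ hτ => by
    refine ((hasDerivAt_integral_sq_add_sq hu hv hp hq (he₁ τ hτ.le) (he₂ τ hτ.le)).sub
      ((hmd τ hτ).pow 2)).congr_deriv ?_
    have hXe : X τ = (∫ t in (0:ℝ)..1, (u (τ, t) * p (τ, t) + v (τ, t) * q (τ, t)))
        - m τ * ∫ t in (0:ℝ)..1, p (τ, t) := by
      rw [← intervalIntegral.integral_const_mul,
        ← intervalIntegral.integral_sub (hi (by fun_prop)) (hi (by fun_prop))]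
      simp only [hX]
      congr 1; ext t; ring
    rw [hXe]
    simp only [hg]
    ring
  have hgd : ∀ τ > 0, HasDerivAt g (-2 * N τ + 4 * Y τ) τ := fun τ hτ =>
    hasDerivAt_integral_asymptotic_form hu hv hp hq hτ (he₁ τ hτ.le) (he₂ τ hτ.le) hbc
  have hwirt {c : ℝ} (hc0 : 0 < c) (hc : c < Real.pi) {τ : ℝ} (hτ : 0 ≤ τ) :
      c ^ 2 * f τ ≤ N τ := by
    have h1 := wirtinger_of_integral_eq_zero (u := fun t => u (τ, t) - m τ)
      (fun t => (hasDerivAt_slice_snd hu τ t).sub_const (m τ)) (hut τ)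
      (by rw [intervalIntegral.integral_sub (hi (hus τ)) (hi continuous_const)]; simp [hm]) hc0 hc
    have h2 := wirtinger_dirichlet (fun t => hasDerivAt_slice_snd hv τ t) (hvt τ)
      (hbc τ hτ).1 (hbc τ hτ).2 hc0 hc
    have hut := hut τ
    have hvt := hvt τ
    simp only [hfm, hN]
    rw [intervalIntegral.integral_add (hi (by fun_prop)) (hi (by fun_prop)),
      intervalIntegral.integral_add (hi (by fun_prop)) (hi (by fun_prop)), mul_add]
    exact add_le_add h1 h2
  set κ := (2 * δ + Real.pi) / 3 with hκ
  set c := (δ + 2 * Real.pi) / 3 with hc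
  have hδκ : δ < κ := by linarith
  have hκc : κ < c := by linarith
  have hcπ : c < Real.pi := by linarith
  have hκ0 : 0 < κ := by linarith
  have hc0 : 0 < c := by linarith
  have hsq : 0 < c ^ 2 - κ ^ 2 := by nlinarith
  set ε := min (κ - δ) ((c ^ 2 - κ ^ 2) / (c ^ 2 + 1)) with hε
  have hε0 : 0 < ε := lt_min (by linarith) (by positivity)
  have hε1 : ε ≤ κ - δ := min_le_left _ _
  have hε2 : ε * (c ^ 2 + 1) ≤ c ^ 2 - κ ^ 2 :=
    (le_div_iff₀ (by positivity)).mp (min_le_right _ _)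
  have hε3 : ε < 1 := by nlinarith [sq_nonneg κ, sq_nonneg c]
  have hXle (τ : ℝ) {d : ℝ} (hd : 0 < d) : |4 * X τ| ≤ d * f τ
      + 4 / d * ∫ t in (0:ℝ)..1, (p (τ, t) ^ 2 + q (τ, t) ^ 2) := by
    rw [hfm]
    exact abs_integral_mul_add_mul_le ((hus τ).sub continuous_const) (hvs τ) (hps τ) (hqs τ) hd
  have hYle (τ : ℝ) : |4 * Y τ| ≤ ε * N τ
      + 4 / ε * ∫ t in (0:ℝ)..1, (p (τ, t) ^ 2 + q (τ, t) ^ 2) := by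
    have h := abs_integral_mul_add_mul_le (hut τ) (hvt τ).neg (hqs τ) (hps τ) hε0
    simp only [Pi.neg_apply, neg_sq, add_comm (q _ ^ 2)] at h
    exact h
  have hK1 : 0 ≤ 4 / ε := by positivity
  have hK2 : 0 ≤ 4 / (ε / κ) := by positivity
  have hfB : ∃ τ₁, ∀ τ ≥ τ₁, f τ ≤ 1 := by
    obtain ⟨τ₁, h⟩ := Filter.eventually_atTop.mp (hconv.eventually_le_const one_pos)
    refine ⟨τ₁, fun τ hτ => ?_⟩
    have := h τ hτ
    rw [hdist] at this
    nlinarith [sq_nonneg (m τ - T)]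
  obtain ⟨τ₁, hτ₁⟩ := hfB
  obtain ⟨M, hM, hfM⟩ := exp_decay_of_differential_inequalities
    (f := f) (h := fun τ => κ * f τ - g τ) (κ := κ) (δ := δ) (ε := ε)
    (K := (4 / ε + κ * (4 / (ε / κ)) + 4 / ε) * A ^ 2) (B := 1) (τ₁ := τ₁)
    hδ0 hε0 (by linarith) (by positivity) (by fun_prop) (by fun_prop) hfd
    (fun τ hτ => ((hfd τ hτ).const_mul κ).sub (hgd τ hτ)) (fun τ _ => hf0 τ) hτ₁
    (fun τ hτ => by
      have h1 := hXle τ hε0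
      have h2 := mul_le_mul_of_nonneg_left (hn τ hτ.le) hK1
      have h3 : 0 ≤ (κ * (4 / (ε / κ)) + 4 / ε) * (A ^ 2 * Real.exp (-(2 * δ) * τ)) := by
        positivity
      have h4 : -2 * g τ + 4 * X τ - (2 * (κ * f τ - g τ) - 2 * κ * f τ) = 4 * X τ := by ring
      rw [h4]
      linarith)
    (fun τ hτ => by
      have h1 := mul_le_mul_of_nonneg_left
        (abs_le.mp (hXle τ (by positivity : 0 < ε / κ))).1 hκ0.le
      have h2 := (abs_le.mp (hYle τ)).2
      have h3 := hn τ hτ.le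
      have h4 := mul_le_mul_of_nonneg_left h3 hK1
      have h5 := mul_le_mul_of_nonneg_left h3 (mul_nonneg hκ0.le hK2)
      have h6 := mul_le_mul_of_nonneg_left (hwirt hc0 hcπ hτ.le) (by linarith : 0 ≤ 2 - ε)
      have h7 := mul_le_mul_of_nonneg_right hε2 (hf0 τ)
      have h8 : 0 ≤ (4 / ε) * (A ^ 2 * Real.exp (-(2 * δ) * τ)) := by positivity
      have h9 : κ * (ε / κ * f τ) = ε * f τ := by field_simp
      have h10 := mul_nonneg hsq.le (hf0 τ)
      linarith)
  have hmT : ∀ τ ≥ 0, |m τ - T| ≤ 2 * A / δ * Real.exp (-δ * τ) := fun τ hτ => by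
    refine abs_sub_le_of_abs_deriv_le_exp hδ0 hmc.continuousOn hmd (fun σ hσ => ?_) ?_ hτ
    · have h1 := (sq_integral_le_integral_sq_add_sq (hps σ) (hqs σ)).trans (hn σ hσ.le)
      have h2 : A ^ 2 * Real.exp (-(2 * δ) * σ) = (A * Real.exp (-δ * σ)) ^ 2 := by
        rw [mul_pow, ← Real.exp_nat_mul]; congr 2; push_cast; ring
      rw [h2] at h1
      have h3 := abs_le_of_sq_le_sq h1 (by positivity)
      rw [abs_mul, abs_two]
      linarith
    · have h1 : Filter.Tendsto (fun τ => (m τ - T) ^ 2) Filter.atTop (nhds 0) :=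
        squeeze_zero (fun τ => sq_nonneg _)
          (fun τ => by rw [hdist]; linarith [hf0 τ]) hconv
      have h2 : Filter.Tendsto (fun τ => |m τ - T|) Filter.atTop (nhds 0) := by
        simpa [Real.sqrt_sq_eq_abs] using h1.sqrt
      simpa using (tendsto_zero_iff_abs_tendsto_zero _).mpr h2 |>.add_const T
  refine ⟨M + (2 * A / δ) ^ 2, by positivity, fun τ hτ => ?_⟩
  have h1 := hfM τ hτ
  have h2 := sq_le_sq' (abs_le.mp (hmT τ hτ)).1 (abs_le.mp (hmT τ hτ)).2
  have h3 : (2 * A / δ * Real.exp (-δ * τ)) ^ 2 = (2 * A / δ) ^ 2 * Real.exp (-(2 * δ) * τ) := by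
    rw [mul_pow, ← Real.exp_nat_mul]; congr 2; push_cast; ring
  rw [hdist]
  linarith

end HalfStrip

/-- Lemma 6.2 (L²-exponential decay of the Reeb component): if `∂̄α = ν` on the
half-strip `[0,∞) × [0,1]`, `α` is real on the two boundary lines, the slice-wise
`L²` norms of `ν` and its first derivatives decay like `C e^{-δτ}` with
`0 < δ < π`, and `α(τ,·) → T ∈ ℝ` uniformly as `τ → ∞`, then
`‖α(τ,·) - T‖_{L²([0,1])} ≤ C̄ e^{-δτ}`. -/
theorem L2_exponential_decay_of_alpha
    (C δ : ℝ) (hC : 0 < C) (hδ0 : 0 < δ) (hδπ : δ < Real.pi)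
    (α ν : ℝ × ℝ → ℂ) (hα : ContDiff ℝ 1 α) (hν : ContDiff ℝ 1 ν) (T : ℝ)
    (heq : ∀ p : ℝ × ℝ, 0 ≤ p.1 → p.2 ∈ Icc (0:ℝ) 1 →
      (1/2 : ℂ) * (deriv (fun τ : ℝ => α (τ, p.2)) p.1
        + Complex.I * deriv (fun t : ℝ => α (p.1, t)) p.2) = ν p)
    (hbc : ∀ τ : ℝ, 0 ≤ τ → (α (τ, 0)).im = 0 ∧ (α (τ, 1)).im = 0)
    (hdecay : ∀ τ : ℝ, 0 ≤ τ →
      Real.sqrt (∫ t in (0:ℝ)..1, ‖ν (τ, t)‖ ^ 2)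
        + Real.sqrt (∫ t in (0:ℝ)..1,
            ‖deriv (fun τ' : ℝ => ν (τ', t)) τ‖ ^ 2
              + ‖deriv (fun t' : ℝ => ν (τ, t')) t‖ ^ 2)
        ≤ C * Real.exp (-δ * τ))
    (hconv : ∀ ε > (0:ℝ), ∃ τ₀ : ℝ, ∀ τ ≥ τ₀, ∀ t ∈ Icc (0:ℝ) 1,
      ‖α (τ, t) - (T : ℂ)‖ < ε) :
    ∃ Cbar > (0:ℝ), ∀ τ : ℝ, 0 ≤ τ →
      Real.sqrt (∫ t in (0:ℝ)..1, ‖α (τ, t) - (T : ℂ)‖ ^ 2)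
        ≤ Cbar * Real.exp (-δ * τ) := by
  have hu : ContDiff ℝ 1 fun z => (α z).re := Complex.reCLM.contDiff.comp hα
  have hv : ContDiff ℝ 1 fun z => (α z).im := Complex.imCLM.contDiff.comp hα
  have hp : Continuous fun z => (ν z).re := Complex.continuous_re.comp hν.continuous
  have hq : Continuous fun z => (ν z).im := Complex.continuous_im.comp hν.continuous
  have hsq (z : ℂ) : ‖z‖ ^ 2 = z.re ^ 2 + z.im ^ 2 := by
    rw [Complex.sq_norm, Complex.normSq_apply]; ring
  have hre (z w : ℝ × ℝ) : fderiv ℝ (fun z => (α z).re) z w = (fderiv ℝ α z w).re := by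
    have := Complex.reCLM.hasFDerivAt.comp z (hα.differentiable one_ne_zero z).hasFDerivAt
    exact congrArg (· w) this.fderiv
  have him (z w : ℝ × ℝ) : fderiv ℝ (fun z => (α z).im) z w = (fderiv ℝ α z w).im := by
    have := Complex.imCLM.hasFDerivAt.comp z (hα.differentiable one_ne_zero z).hasFDerivAt
    exact congrArg (· w) this.fderiv
  have hd1 (τ t : ℝ) : deriv (fun s => α (s, t)) τ = fderiv ℝ α (τ, t) (1, 0) :=
    ((hα.differentiable one_ne_zero (τ, t)).hasFDerivAt.comp_hasDerivAt τ
      ((hasDerivAt_id τ).prodMk (hasDerivAt_const τ t))).deriv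
  have hd2 (τ t : ℝ) : deriv (fun s => α (τ, s)) t = fderiv ℝ α (τ, t) (0, 1) :=
    ((hα.differentiable one_ne_zero (τ, t)).hasFDerivAt.comp_hasDerivAt t
      ((hasDerivAt_const t τ).prodMk (hasDerivAt_id t))).deriv
  have hCR (τ : ℝ) (hτ : 0 ≤ τ) (t : ℝ) (ht : t ∈ Icc (0:ℝ) 1) :
      fderiv ℝ α (τ, t) (1, 0) + Complex.I * fderiv ℝ α (τ, t) (0, 1) = 2 * ν (τ, t) := by
    have h := heq (τ, t) hτ ht
    simp only [hd1, hd2] at h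
    rw [← h]; ring
  have hexp (τ : ℝ) : Real.exp (-(2 * δ) * τ) = Real.exp (-δ * τ) ^ 2 := by
    rw [← Real.exp_nat_mul]; congr 1; push_cast; ring
  have hdist (τ t : ℝ) : ((α (τ, t)).re - T) ^ 2 + (α (τ, t)).im ^ 2 = ‖α (τ, t) - (T : ℂ)‖ ^ 2 := by
    rw [hsq]; simp
  obtain ⟨M, hM, hle⟩ := exp_decay_of_cauchyRiemann (T := T) hC.le hδ0 hδπ hu hv hp hq
    (fun τ hτ t ht => by
      have := congrArg Complex.re (hCR τ hτ t ht)
      simp at this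
      rw [hre, him]; linarith)
    (fun τ hτ t ht => by
      have := congrArg Complex.im (hCR τ hτ t ht)
      simp at this
      rw [hre, him]; linarith)
    hbc
    (fun τ hτ => by
      have h1 := (le_add_of_nonneg_right (Real.sqrt_nonneg _)).trans (hdecay τ hτ)
      rw [Real.sqrt_le_left (by positivity), mul_pow, ← hexp] at h1
      simpa only [hsq] using h1)
    (by
      simp only [hdist]
      rw [Metric.tendsto_atTop]
      intro ε hε
      obtain ⟨τ₀, h⟩ := hconv (Real.sqrt (ε / 2)) (by positivity)
      refine ⟨τ₀, fun τ hτ => ?_⟩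
      have hc : Continuous fun t => ‖α (τ, t) - (T : ℂ)‖ ^ 2 := by
        have := hα.continuous
        fun_prop
      have h1 : (∫ t in (0:ℝ)..1, ‖α (τ, t) - (T : ℂ)‖ ^ 2) ≤ ∫ _ in (0:ℝ)..1, ε / 2 :=
        intervalIntegral.integral_mono_on zero_le_one (hc.intervalIntegrable _ _)
          (continuous_const.intervalIntegrable _ _) fun t ht => by
            rw [← Real.sq_sqrt (by positivity : 0 ≤ ε / 2)]
            exact pow_le_pow_left₀ (norm_nonneg _) (h τ hτ t ht).le 2
      have h0 : 0 ≤ ∫ t in (0:ℝ)..1, ‖α (τ, t) - (T : ℂ)‖ ^ 2 :=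
        intervalIntegral.integral_nonneg zero_le_one fun t _ => by positivity
      rw [Real.dist_0_eq_abs, abs_of_nonneg h0]
      simp at h1
      linarith)
  refine ⟨Real.sqrt M, Real.sqrt_pos.mpr hM, fun τ hτ => ?_⟩
  rw [Real.sqrt_le_left (by positivity), mul_pow, Real.sq_sqrt hM.le, ← hexp]
  simpa only [hdist] using hle τ hτ
end
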